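/- Let Γ₀ ≤ SO(2,1)⁰ be a Schottky group generated by a finite set S, and let u : Γ₀ → ℝ³ be a cocycle whose associated affine deformation acts properly discontinuously on ℝ³. Then there exists ε > 0 such that every cocycle u' : Γ₀ → ℝ³ with ‖u'(γ) − u(γ)‖ < ε for all γ ∈ S also has properly discontinuous associated affine deformation. In other words, the set of properly discontinuous affine deformations is open in the space of cocycles. -/

import Mathlib

open Matrix

noncomputable section

/-- The Lorentzian bilinear form on `ℝ³`: `B(v,w) = v₁w₁ + v₂w₂ − v₃w₃`. -/
def Bform (v w : Fin 3 → ℝ) : ℝ := v 0 * w 0 + v 1 * w 1 - v 2 * w 2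

/-- `SO(2,1)⁰`: linear automorphisms of `ℝ³` preserving `B`, with determinant 1,
preserving the future cone `{v | B(v,v) < 0, v₃ > 0}`. -/
def SO21 (γ : Matrix (Fin 3) (Fin 3) ℝ) : Prop :=
  (∀ v w : Fin 3 → ℝ, Bform (γ.mulVec v) (γ.mulVec w) = Bform v w) ∧
  γ.det = 1 ∧
  (∀ v : Fin 3 → ℝ, Bform v v < 0 → 0 < v 2 → 0 < γ.mulVec v 2)

/-- A matrix is hyperbolic if it has an eigenvalue `λ > 1`. -/
def IsHyperbolic (γ : Matrix (Fin 3) (Fin 3) ℝ) : Prop :=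
  ∃ lam : ℝ, 1 < lam ∧ ∃ v : Fin 3 → ℝ, v ≠ 0 ∧ γ.mulVec v = lam • v

/-- `x0` is the neutral vector of `γ`: fixed by `γ`, of unit `B`-norm, and such that
`det(x₋, x⁰, x₊) > 0` for (any) future-pointing eigenvectors `x₋, x₊` of `γ` for the
eigenvalues `λ > 1` and `λ⁻¹`. -/
def IsNeutral (γ : Matrix (Fin 3) (Fin 3) ℝ) (x0 : Fin 3 → ℝ) : Prop :=
  γ.mulVec x0 = x0 ∧ Bform x0 x0 = 1 ∧
  (∀ (lam : ℝ) (xm xp : Fin 3 → ℝ), 1 < lam → xm ≠ 0 → xp ≠ 0 →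
    γ.mulVec xm = lam • xm → γ.mulVec xp = lam⁻¹ • xp →
    0 < xm 2 → 0 < xp 2 → 0 < (Matrix.of ![xm, x0, xp]).det)

/-- The underlying matrix of an element of a subgroup of `GL(3,ℝ)`. -/
def toM {Γ₀ : Subgroup (Matrix (Fin 3) (Fin 3) ℝ)ˣ} (γ : Γ₀) : Matrix (Fin 3) (Fin 3) ℝ :=
  ((γ : (Matrix (Fin 3) (Fin 3) ℝ)ˣ) : Matrix (Fin 3) (Fin 3) ℝ)

/-- A Schottky group: a nonabelian discrete subgroup of `SO(2,1)⁰` all of whose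
nontrivial elements are hyperbolic. -/
def IsSchottky (Γ₀ : Subgroup (Matrix (Fin 3) (Fin 3) ℝ)ˣ) : Prop :=
  (∀ γ : Γ₀, SO21 (toM γ)) ∧
  DiscreteTopology Γ₀ ∧
  (∃ a b : Γ₀, a * b ≠ b * a) ∧
  (∀ γ : Γ₀, γ ≠ 1 → IsHyperbolic (toM γ))

/-- A cocycle `u : Γ₀ → ℝ³`, i.e. `u(γ₁γ₂) = u(γ₁) + γ₁ u(γ₂)`. -/
def IsCocycle (Γ₀ : Subgroup (Matrix (Fin 3) (Fin 3) ℝ)ˣ) (u : Γ₀ → Fin 3 → ℝ) : Prop :=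
  ∀ γ₁ γ₂ : Γ₀, u (γ₁ * γ₂) = u γ₁ + (toM γ₁).mulVec (u γ₂)

/-- The affine deformation `γ·x = γx + u(γ)` acts properly discontinuously on `ℝ³`. -/
def ProperlyDisc (Γ₀ : Subgroup (Matrix (Fin 3) (Fin 3) ℝ)ˣ) (u : Γ₀ → Fin 3 → ℝ) : Prop :=
  ∀ K : Set (Fin 3 → ℝ), IsCompact K →
    {γ : Γ₀ | ∃ x ∈ K, (toM γ).mulVec x + u γ ∈ K}.Finite


/-- The Euclidean norm on `ℝ³`. -/
def enorm3 (v : Fin 3 → ℝ) : ℝ := Real.sqrt (v 0 ^ 2 + v 1 ^ 2 + v 2 ^ 2)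



/-! ### Basic Lorentz algebra -/

def e3 : Fin 3 → ℝ := ![0, 0, 1]

def Hyp (x : Fin 3 → ℝ) : Prop := Bform x x = -1 ∧ 0 < x 2

def Dd (a b : Fin 3 → ℝ) : ℝ := a 0 * b 1 - a 1 * b 0

def Det3 (a b c : Fin 3 → ℝ) : ℝ :=
  a 0 * (b 1 * c 2 - b 2 * c 1) - a 1 * (b 0 * c 2 - b 2 * c 0) + a 2 * (b 0 * c 1 - b 1 * c 0)

def orb {Γ₀ : Subgroup (Matrix (Fin 3) (Fin 3) ℝ)ˣ} (γ : Γ₀) : Fin 3 → ℝ := toM γ *ᵥ e3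

def nm (w : Fin 3 → ℝ) : ℝ := |w 0| + |w 1| + |w 2|

lemma Bform_comm (v w : Fin 3 → ℝ) : Bform v w = Bform w v := by
  unfold Bform; ring

lemma Bform_add_left (a b c : Fin 3 → ℝ) : Bform (a + b) c = Bform a c + Bform b c := by
  simp only [Bform, Pi.add_apply]; ring

lemma Bform_add_right (a b c : Fin 3 → ℝ) : Bform c (a + b) = Bform c a + Bform c b := by
  simp only [Bform, Pi.add_apply]; ring

lemma Bform_sub_left (a b c : Fin 3 → ℝ) : Bform (a - b) c = Bform a c - Bform b c := by
  simp only [Bform, Pi.sub_apply]; ring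

lemma Bform_smul_left (t : ℝ) (a c : Fin 3 → ℝ) : Bform (t • a) c = t * Bform a c := by
  simp only [Bform, Pi.smul_apply, smul_eq_mul]; ring

lemma Bform_smul_right (t : ℝ) (a c : Fin 3 → ℝ) : Bform c (t • a) = t * Bform c a := by
  simp only [Bform, Pi.smul_apply, smul_eq_mul]; ring

lemma Bform_e3 (a : Fin 3 → ℝ) : Bform a e3 = - a 2 := by
  simp [Bform, e3]

lemma Bform_e3' (a : Fin 3 → ℝ) : Bform e3 a = - a 2 := by
  simp [Bform, e3]

lemma gram (x y z : Fin 3 → ℝ) :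
    Bform x x * (Bform y y * Bform z z - Bform y z ^ 2)
      - Bform x y * (Bform x y * Bform z z - Bform y z * Bform x z)
      + Bform x z * (Bform x y * Bform y z - Bform y y * Bform x z) = - Det3 x y z ^ 2 := by
  unfold Bform Det3; ring

lemma Hyp_e3 : Hyp e3 := by
  constructor <;> simp [Bform, e3]

lemma Hyp.sq {x : Fin 3 → ℝ} (h : Hyp x) : x 0 ^ 2 + x 1 ^ 2 + 1 = x 2 ^ 2 := by
  have := h.1; unfold Bform at this; linarith

lemma Hyp.one_le {x : Fin 3 → ℝ} (h : Hyp x) : 1 ≤ x 2 := by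
  have := h.sq; have := h.2; nlinarith [sq_nonneg (x 0), sq_nonneg (x 1)]

lemma Hyp.abs0 {x : Fin 3 → ℝ} (h : Hyp x) : |x 0| ≤ x 2 := by
  have := h.sq; exact abs_le_of_sq_le_sq (by nlinarith [sq_nonneg (x 1)]) h.2.le

lemma Hyp.abs1 {x : Fin 3 → ℝ} (h : Hyp x) : |x 1| ≤ x 2 := by
  have := h.sq; exact abs_le_of_sq_le_sq (by nlinarith [sq_nonneg (x 0)]) h.2.le

lemma Hyp.one_le_B {x y : Fin 3 → ℝ} (hx : Hyp x) (hy : Hyp y) : 1 ≤ - Bform x y := by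
  have h1 := hx.sq
  have h2 := hy.sq
  have h3 := hx.2
  have h4 := hy.2
  have : x 0 * y 0 + x 1 * y 1 + 1 ≤ x 2 * y 2 := by
    apply le_of_sq_le_sq _ (by positivity)
    rw [mul_pow, ← h1, ← h2]
    nlinarith [sq_nonneg (x 0 * y 1 - x 1 * y 0), sq_nonneg (x 0 - y 0), sq_nonneg (x 1 - y 1)]
  unfold Bform; linarith

lemma tri {x y z : Fin 3 → ℝ} (hx : Hyp x) (hy : Hyp y) (hz : Hyp z) :
    - Bform x z ≤ 2 * (- Bform x y) * (- Bform y z) := by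
  have h := gram x y z
  rw [hx.1, hy.1, hz.1] at h
  have h1 := hx.one_le_B hy
  have h2 := hy.one_le_B hz
  have h3 := hx.one_le_B hz
  set k := - Bform x y
  set l := - Bform y z
  set m := - Bform x z
  have e1 : Bform x y = -k := by simp [k]
  have e2 : Bform y z = -l := by simp [l]
  have e3 : Bform x z = -m := by simp [m]
  rw [e1, e2, e3] at h
  by_contra hc
  push Not at hc
  nlinarith [sq_nonneg (Det3 x y z), mul_pos (show (0:ℝ) < m by linarith) (sub_pos.2 hc),
    mul_self_nonneg k, mul_self_nonneg l]

/-- null future vector -/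
def Nul (a : Fin 3 → ℝ) : Prop := Bform a a = 0 ∧ 0 < a 2

lemma Nul.sq {a : Fin 3 → ℝ} (h : Nul a) : a 0 ^ 2 + a 1 ^ 2 = a 2 ^ 2 := by
  have := h.1; unfold Bform at this; linarith

lemma Nul.pos {a x : Fin 3 → ℝ} (ha : Nul a) (hx : Hyp x) : 0 < - Bform a x := by
  have h1 := ha.sq
  have h2 := hx.sq
  have h3 := ha.2
  have h4 := hx.2
  have : a 0 * x 0 + a 1 * x 1 < a 2 * x 2 := by
    apply lt_of_pow_lt_pow_left₀ 2 (by positivity)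
    rw [mul_pow, ← h1, ← h2]
    have : 0 < a 0 ^ 2 + a 1 ^ 2 := by rw [h1]; positivity
    nlinarith [sq_nonneg (a 0 * x 1 - a 1 * x 0)]
  unfold Bform; linarith

lemma Nul.adj {a x y : Fin 3 → ℝ} (ha : Nul a) (hx : Hyp x) (hy : Hyp y) {K : ℝ}
    (hK : - Bform x y ≤ K) : - Bform a x ≤ 2 * K * (- Bform a y) := by
  have h := gram a x y
  rw [hx.1, hy.1, ha.1] at h
  have h1 := ha.pos hx
  have h2 := ha.pos hy
  have h3 := hx.one_le_B hy
  set k := - Bform x y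
  set P := - Bform a x
  set Q := - Bform a y
  have e1 : Bform x y = -k := by simp [k]
  have e2 : Bform a x = -P := by simp [P]
  have e3 : Bform a y = -Q := by simp [Q]
  rw [e1, e2, e3] at h
  have : P * P ≤ P * (2 * k * Q) := by nlinarith [sq_nonneg (Det3 a x y), sq_nonneg Q]
  have := le_of_mul_le_mul_left this h1
  nlinarith

lemma nm_nonneg (w : Fin 3 → ℝ) : 0 ≤ nm w := by unfold nm; positivity

lemma Bform_le_nm (w x : Fin 3 → ℝ) {c : ℝ} (h0 : |x 0| ≤ c) (h1 : |x 1| ≤ c) (h2 : |x 2| ≤ c) :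
    |Bform w x| ≤ nm w * c := by
  unfold Bform nm
  calc |w 0 * x 0 + w 1 * x 1 - w 2 * x 2| ≤ |w 0 * x 0| + |w 1 * x 1| + |w 2 * x 2| := by
        refine (abs_sub _ _).trans ?_
        gcongr; exact abs_add_le _ _
    _ = |w 0| * |x 0| + |w 1| * |x 1| + |w 2| * |x 2| := by simp only [abs_mul]
    _ ≤ |w 0| * c + |w 1| * c + |w 2| * c := by gcongr
    _ = _ := by ring

lemma Hyp.B_le {x : Fin 3 → ℝ} (hx : Hyp x) (w : Fin 3 → ℝ) : |Bform w x| ≤ nm w * x 2 :=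
  Bform_le_nm w x hx.abs0 hx.abs1 (abs_of_pos hx.2).le

/-! ### Group action -/

section act
variable {Γ₀ : Subgroup (Matrix (Fin 3) (Fin 3) ℝ)ˣ}

lemma toM_mul (a b : Γ₀) : toM (a * b) = toM a * toM b := by simp [toM]

lemma toM_one : toM (1 : Γ₀) = 1 := by simp [toM]

lemma act_mul (a b : Γ₀) (v : Fin 3 → ℝ) : toM (a * b) *ᵥ v = toM a *ᵥ (toM b *ᵥ v) := by
  rw [toM_mul, Matrix.mulVec_mulVec]

lemma act_one (v : Fin 3 → ℝ) : toM (1 : Γ₀) *ᵥ v = v := by rw [toM_one, Matrix.one_mulVec]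

lemma act_inv_act (a : Γ₀) (v : Fin 3 → ℝ) : toM a⁻¹ *ᵥ (toM a *ᵥ v) = v := by
  rw [← act_mul, inv_mul_cancel, act_one]

lemma act_act_inv (a : Γ₀) (v : Fin 3 → ℝ) : toM a *ᵥ (toM a⁻¹ *ᵥ v) = v := by
  rw [← act_mul, mul_inv_cancel, act_one]

lemma orb_one : orb (1 : Γ₀) = e3 := act_one _

lemma orb_mul (a b : Γ₀) : orb (a * b) = toM a *ᵥ orb b := act_mul _ _ _

lemma B_act (h : ∀ γ : Γ₀, SO21 (toM γ)) (a : Γ₀) (v w : Fin 3 → ℝ) :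
    Bform (toM a *ᵥ v) (toM a *ᵥ w) = Bform v w := (h a).1 v w

lemma B_act_left (h : ∀ γ : Γ₀, SO21 (toM γ)) (a : Γ₀) (v w : Fin 3 → ℝ) :
    Bform (toM a *ᵥ v) w = Bform v (toM a⁻¹ *ᵥ w) := by
  conv_lhs => rw [← act_act_inv a w]
  exact B_act h a _ _

lemma Hyp_act (h : ∀ γ : Γ₀, SO21 (toM γ)) (a : Γ₀) {x : Fin 3 → ℝ} (hx : Hyp x) :
    Hyp (toM a *ᵥ x) :=
  ⟨by rw [B_act h]; exact hx.1, (h a).2.2 x (by rw [hx.1]; norm_num) hx.2⟩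

lemma Hyp_orb (h : ∀ γ : Γ₀, SO21 (toM γ)) (a : Γ₀) : Hyp (orb a) := Hyp_act h a Hyp_e3

lemma Nul_act (h : ∀ γ : Γ₀, SO21 (toM γ)) (a : Γ₀) {x : Fin 3 → ℝ} (hx : Nul x) :
    Nul (toM a *ᵥ x) := by
  refine ⟨by rw [B_act h]; exact hx.1, ?_⟩
  have h1 := hx.pos (Hyp_orb h a⁻¹)
  rw [orb, ← B_act_left h, Bform_e3] at h1
  linarith

lemma orb_inv_two (h : ∀ γ : Γ₀, SO21 (toM γ)) (a : Γ₀) : orb a⁻¹ 2 = orb a 2 := by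
  have h1 := B_act_left h a e3 e3
  rw [Bform_e3, Bform_e3'] at h1
  simp only [orb]; linarith

/-- `-B(orb a, orb b)` is the displacement of `a⁻¹ b`. -/
lemma B_orb (h : ∀ γ : Γ₀, SO21 (toM γ)) (a b : Γ₀) :
    - Bform (orb a) (orb b) = orb (a⁻¹ * b) 2 := by
  rw [orb, B_act_left h, ← orb_mul, Bform_e3', neg_neg]

lemma Det3_act (h : ∀ γ : Γ₀, SO21 (toM γ)) (g : Γ₀) (a b c : Fin 3 → ℝ) :
    Det3 (toM g *ᵥ a) (toM g *ᵥ b) (toM g *ᵥ c) = Det3 a b c := by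
  have hd := (h g).2.1
  rw [Matrix.det_fin_three] at hd
  have : Det3 (toM g *ᵥ a) (toM g *ᵥ b) (toM g *ᵥ c) = (toM g 0 0 * toM g 1 1 * toM g 2 2 - toM g 0 0 * toM g 1 2 * toM g 2 1 - toM g 0 1 * toM g 1 0 * toM g 2 2 + toM g 0 1 * toM g 1 2 * toM g 2 0 + toM g 0 2 * toM g 1 0 * toM g 2 1 - toM g 0 2 * toM g 1 1 * toM g 2 0) * Det3 a b c := by
    simp only [Det3, Matrix.mulVec, dotProduct, Fin.sum_univ_three]
    ring
  rw [this, hd, one_mul]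

lemma Det3_e3 (a b : Fin 3 → ℝ) : Det3 a b e3 = Dd a b := by
  simp [Det3, Dd, e3]

/-! ### Discreteness -/

lemma entry_bound (h : ∀ γ : Γ₀, SO21 (toM γ)) (g : Γ₀) {M : ℝ} (hM : orb g 2 ≤ M)
    (i j : Fin 3) : |toM g i j| ≤ M + 1 := by
  have key : ∀ (k : Fin 3), toM g k 2 = orb g k := by
    intro k; simp [orb, e3, Matrix.mulVec, dotProduct, Fin.sum_univ_three]
  have hp := Hyp_orb h g
  have hp' := Hyp_orb h g⁻¹
  have hinv := orb_inv_two h g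
  have hM1 := hp.one_le
  have col : ∀ (k : Fin 3) (f : Fin 3 → ℝ), (∀ i, f i = toM g i k) → Bform f f = 1 →
      |f 2| ≤ M → |toM g i k| ≤ M + 1 := by
    intro k f hf hB h2
    have hs : f 0 ^ 2 + f 1 ^ 2 = 1 + f 2 ^ 2 := by unfold Bform at hB; linarith
    have h2' : f 2 ^ 2 ≤ M ^ 2 := by
      rw [← sq_abs (f 2)]; gcongr
    rw [← hf]
    have : ∀ i, f i ^ 2 ≤ (M + 1) ^ 2 := by
      intro i; fin_cases i <;> simp <;> nlinarith [sq_nonneg (f 0), sq_nonneg (f 1)]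
    exact abs_le_of_sq_le_sq (this i) (by linarith)
  have e0 : ∀ i, (toM g *ᵥ ![1,0,0]) i = toM g i 0 := by
    intro k; simp [Matrix.mulVec, dotProduct, Fin.sum_univ_three]
  have e1 : ∀ i, (toM g *ᵥ ![0,1,0]) i = toM g i 1 := by
    intro k; simp [Matrix.mulVec, dotProduct, Fin.sum_univ_three]
  have row : ∀ v : Fin 3 → ℝ, (toM g *ᵥ v) 2 = - Bform v (orb g⁻¹) := by
    intro v; rw [orb, ← B_act_left h, Bform_e3, neg_neg]
  fin_cases j
  · refine col 0 _ e0 (by rw [B_act h]; simp [Bform]) ?_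
    rw [row]
    have := hp'.abs0
    simp [Bform]
    linarith
  · refine col 1 _ e1 (by rw [B_act h]; simp [Bform]) ?_
    rw [row]
    have := hp'.abs1
    simp [Bform]
    linarith
  · show |toM g i 2| ≤ _
    rw [key]
    have a0 := hp.abs0
    have a1 := hp.abs1
    have a2 := abs_of_pos hp.2
    fin_cases i <;> simp <;> linarith

lemma finite_orb (h : ∀ γ : Γ₀, SO21 (toM γ)) (hd : DiscreteTopology Γ₀) (M : ℝ) :
    {γ : Γ₀ | orb γ 2 ≤ M}.Finite := by
  have hcl : IsClosed (Γ₀ : Set (Matrix (Fin 3) (Fin 3) ℝ)ˣ) := Subgroup.isClosed_of_discrete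
  set K : Set (Matrix (Fin 3) (Fin 3) ℝ) :=
    Set.pi Set.univ fun _ => Set.pi Set.univ fun _ => Set.Icc (-(M+1)) (M+1)
  have hK : IsCompact K := isCompact_univ_pi fun _ => isCompact_univ_pi fun _ => isCompact_Icc
  have hKK : IsCompact (Units.embedProduct (Matrix (Fin 3) (Fin 3) ℝ) ⁻¹'
      (K ×ˢ (MulOpposite.unop ⁻¹' K))) := by
    apply Units.isClosedEmbedding_embedProduct.isCompact_preimage
    apply hK.prod
    exact MulOpposite.opHomeomorph.symm.isClosedEmbedding.isCompact_preimage hK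
  have hc : IsCompact ((Subtype.val : Γ₀ → _) ⁻¹' (Units.embedProduct (Matrix (Fin 3) (Fin 3) ℝ) ⁻¹'
      (K ×ˢ (MulOpposite.unop ⁻¹' K)))) :=
    hcl.isClosedEmbedding_subtypeVal.isCompact_preimage hKK
  refine hc.finite_of_discrete.subset ?_
  intro g hg
  simp only [Set.mem_preimage, Units.embedProduct_apply]
  constructor
  · intro i _ j _; exact abs_le.1 (entry_bound h g hg i j)
  · intro i _ j _
    have : orb g⁻¹ 2 ≤ M := by rw [orb_inv_two h]; exact hg
    exact abs_le.1 (entry_bound h g⁻¹ this i j)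

end act


/-! ### Exit estimate -/

lemma exit_aux {a x y z : Fin 3 → ℝ} {K t lam : ℝ} (hK : 1 ≤ K) (ha : Nul a) (hx : Hyp x)
    (hy : Hyp y) (hxy : - Bform x y ≤ K) (ht0 : 0 ≤ t) (ht1 : t ≤ 1)
    (hz : z = (1 - t) • x + t • y) (hlam : 0 ≤ lam) (hz0 : z 0 = lam * a 0)
    (hz1 : z 1 = lam * a 1)
    (hP : a 2 ≤ 2 * (- Bform a x) ∨ a 2 ≤ 2 * (- Bform a y)) : x 2 ≤ 8 * K ^ 3 := by
  have A1 := ha.adj hx hy hxy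
  have A2 := ha.adj (K := K) hy hx (by rw [Bform_comm]; exact hxy)
  have p1 := ha.pos hx
  have p2 := ha.pos hy
  have q1 : a 2 ≤ 4 * K * (- Bform a x) := by
    rcases hP with h | h
    · nlinarith
    · nlinarith
  have q2 : a 2 ≤ 4 * K * (- Bform a y) := by
    rcases hP with h | h
    · nlinarith
    · nlinarith
  have q3 : a 2 ≤ 4 * K * (- Bform a z) := by
    have : Bform a z = (1 - t) * Bform a x + t * Bform a y := by
      rw [hz, Bform_add_right, Bform_smul_right, Bform_smul_right]
    rw [this]
    nlinarith [mul_le_mul_of_nonneg_left q1 (sub_nonneg.2 ht1), mul_le_mul_of_nonneg_left q2 ht0]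
  have hsq := ha.sq
  have ha2 := ha.2
  have hB : - Bform a z = a 2 * (z 2 - lam * a 2) := by
    unfold Bform; rw [hz0, hz1]; linear_combination lam * (- hsq)
  have q4 : 1 ≤ 4 * K * (z 2 - lam * a 2) := by
    rw [hB] at q3
    have : a 2 * 1 ≤ a 2 * (4 * K * (z 2 - lam * a 2)) := by linarith
    exact le_of_mul_le_mul_left this ha2
  have hzz : - Bform z z ≤ K := by
    have : Bform z z = (1-t)^2 * Bform x x + t ^ 2 * Bform y y + 2 * t * (1-t) * Bform x y := by
      rw [hz]; simp only [Bform, Pi.add_apply, Pi.smul_apply, smul_eq_mul]; ring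
    rw [this, hx.1, hy.1]
    nlinarith [mul_nonneg ht0 (sub_nonneg.2 ht1), mul_le_mul_of_nonneg_left hxy (mul_nonneg ht0 (sub_nonneg.2 ht1)), mul_le_mul_of_nonneg_left hK (sq_nonneg t), mul_le_mul_of_nonneg_left hK (sq_nonneg (1-t))]
  have hzz2 : - Bform z z = (z 2 - lam * a 2) * (z 2 + lam * a 2) := by
    unfold Bform; rw [hz0, hz1]; linear_combination -lam^2 * hsq
  have hx2 := hx.2
  have hy2 := hy.2
  have hz2 : z 2 = (1 - t) * x 2 + t * y 2 := by rw [hz]; simp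
  have hz2p : 0 ≤ z 2 := by
    rw [hz2]; have := sub_nonneg.2 ht1; positivity
  have q5 : z 2 ≤ 4 * K ^ 2 := by
    have hs : 0 ≤ z 2 + lam * a 2 := by positivity
    have h1 : z 2 + lam * a 2 ≤ 4 * K * ((z 2 - lam * a 2) * (z 2 + lam * a 2)) := by
      nlinarith [mul_le_mul_of_nonneg_right q4 hs]
    have h2 : 0 ≤ lam * a 2 := by positivity
    rw [← hzz2] at h1
    nlinarith
  have q6 : x 2 ≤ 2 * K * y 2 := by
    have := tri hx hy Hyp_e3
    rw [Bform_e3, Bform_e3, neg_neg, neg_neg] at this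
    nlinarith
  have q7 : x 2 ≤ 2 * K * z 2 := by
    rw [hz2]
    have : x 2 ≤ 2 * K * x 2 := by nlinarith
    nlinarith [mul_le_mul_of_nonneg_left q6 ht0, mul_le_mul_of_nonneg_left this (sub_nonneg.2 ht1)]
  calc x 2 ≤ 2 * K * z 2 := q7
    _ ≤ 2 * K * (4 * K ^ 2) := by gcongr
    _ = _ := by ring

lemma Dd_cramer (a b z : Fin 3 → ℝ) (i : Fin 3) (hi : i ≠ 2) :
    Dd a b * z i = Dd z b * a i + Dd a z * b i := by
  fin_cases i
  · simp [Dd]; ring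
  · simp [Dd]; ring
  · exact absurd rfl hi

lemma exit_lemma {a b x y : Fin 3 → ℝ} {K σ : ℝ} (hK : 1 ≤ K) (ha : Nul a)
    (hb : Nul b) (hx : Hyp x) (hy : Hyp y) (hxy : - Bform x y ≤ K)
    (hab : 0 < σ * Dd a b) (hax : 0 < σ * Dd a x) (hbx : σ * Dd b x < 0)
    (hny : ¬ (0 < σ * Dd a y ∧ σ * Dd b y < 0))
    (Pax : 0 ≤ σ * Dd a x → a 2 ≤ 2 * (- Bform a x))
    (Pby : 0 ≤ σ * Dd b y → b 2 ≤ 2 * (- Bform b y)) : x 2 ≤ 8 * K ^ 3 := by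
  set f : ℝ → ℝ := fun t => min ((1-t) * (σ * Dd a x) + t * (σ * Dd a y))
    ((1-t) * (- (σ * Dd b x)) + t * (-(σ * Dd b y))) with hf
  have hfc : Continuous f := by rw [hf]; fun_prop
  have hf0 : 0 < f 0 := by simp [hf]; exact ⟨hax, hbx⟩
  have hf1 : f 1 ≤ 0 := by
    simp only [hf, sub_self, zero_mul, one_mul, zero_add, min_le_iff]
    by_contra hc
    push Not at hc
    exact hny ⟨hc.1, by linarith [hc.2]⟩
  obtain ⟨t, ⟨ht0, ht1⟩, hft⟩ := intermediate_value_Icc' (zero_le_one' ℝ) hfc.continuousOn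
    (show (0:ℝ) ∈ Set.Icc (f 1) (f 0) from ⟨hf1, hf0.le⟩)
  have l1 : 0 ≤ (1-t) * (σ * Dd a x) + t * (σ * Dd a y) := by
    rw [← hft]; exact min_le_left _ _
  have l2 : 0 ≤ (1-t) * (- (σ * Dd b x)) + t * (-(σ * Dd b y)) := by
    rw [← hft]; exact min_le_right _ _
  set z := (1 - t) • x + t • y with hz
  have za : σ * Dd a z = (1-t) * (σ * Dd a x) + t * (σ * Dd a y) := by
    simp only [hz, Dd, Pi.add_apply, Pi.smul_apply, smul_eq_mul]; ring
  have zb : σ * Dd z b = (1-t) * (- (σ * Dd b x)) + t * (-(σ * Dd b y)) := by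
    simp only [hz, Dd, Pi.add_apply, Pi.smul_apply, smul_eq_mul]; ring
  have hz' : ∀ i : Fin 3, i ≠ 2 → z i = (σ * Dd z b / (σ * Dd a b)) * a i
      + (σ * Dd a z / (σ * Dd a b)) * b i := by
    intro i hi
    have := Dd_cramer a b z i hi
    rw [div_mul_eq_mul_div, div_mul_eq_mul_div, ← add_div, eq_div_iff hab.ne']
    linear_combination σ * this
  have hmin : min (σ * Dd a z) (σ * Dd z b) = 0 := by rw [za, zb]; exact hft
  rcases min_choice (σ * Dd a z) (σ * Dd z b) with hm | hm
  · rw [hm] at hmin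
    refine exit_aux (lam := σ * Dd z b / (σ * Dd a b)) hK ha hx hy hxy ht0 ht1 hz ?_ ?_ ?_
      (Or.inl (Pax hax.le))
    · rw [zb]; exact div_nonneg l2 hab.le
    · rw [hz' 0 (by decide), hmin]; simp
    · rw [hz' 1 (by decide), hmin]; simp
  · rw [hm] at hmin
    refine exit_aux (lam := σ * Dd a z / (σ * Dd a b)) hK hb hx hy hxy ht0 ht1 hz ?_ ?_ ?_
      (Or.inr (Pby ?_))
    · rw [za]; exact div_nonneg l1 hab.le
    · rw [hz' 0 (by decide), hmin]; simp
    · rw [hz' 1 (by decide), hmin]; simp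
    · rw [zb] at hmin
      by_contra hc
      push Not at hc
      rcases eq_or_lt_of_le ht0 with h0 | h0
      · rw [← h0] at hmin; linarith
      · nlinarith [mul_pos h0 (neg_pos.2 hc), mul_nonneg (sub_nonneg.2 ht1) (neg_pos.2 hbx).le]

/-! ### Fixed null directions -/

section core
variable {Γ₀ : Subgroup (Matrix (Fin 3) (Fin 3) ℝ)ˣ}

lemma pow_act (g : Γ₀) (ξ : Fin 3 → ℝ) (lam : ℝ) (hg : toM g *ᵥ ξ = lam • ξ) (n : ℕ) :
    toM (g ^ n) *ᵥ ξ = lam ^ n • ξ := by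
  induction n with
  | zero => simp [act_one]
  | succ k ih => rw [pow_succ', act_mul, ih, Matrix.mulVec_smul, hg, smul_smul, pow_succ]

lemma fix_ge_one (h : ∀ γ : Γ₀, SO21 (toM γ)) {ξ : Fin 3 → ℝ} (hξ2 : ξ 2 = 1)
    (hi : ∀ δ : Γ₀, 1 / 2 ≤ - Bform ξ (orb δ)) (g : Γ₀) (lam : ℝ)
    (hg : toM g *ᵥ ξ = lam • ξ) : 1 ≤ lam := by
  have key : ∀ n : ℕ, 1 / 2 ≤ lam ^ n := by
    intro n
    have h1 := hi (g ^ n)⁻¹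
    rw [orb, ← B_act_left h, pow_act g ξ lam hg, Bform_e3, neg_neg] at h1
    simpa [hξ2] using h1
  by_contra hc
  push Not at hc
  have h0 : 0 ≤ lam := by have := key 1; norm_num at this; linarith
  obtain ⟨n, hn⟩ := exists_pow_lt_of_lt_one (show (0:ℝ) < 1/2 by norm_num) hc
  linarith [key n]

lemma no_fix (h : ∀ γ : Γ₀, SO21 (toM γ)) (hh : ∀ γ : Γ₀, γ ≠ 1 → IsHyperbolic (toM γ))
    {ξ : Fin 3 → ℝ} (hξ : Nul ξ) (hξ2 : ξ 2 = 1)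
    (hi : ∀ δ : Γ₀, 1 / 2 ≤ - Bform ξ (orb δ)) (g : Γ₀) (hg1 : g ≠ 1) (lam : ℝ)
    (hg : toM g *ᵥ ξ = lam • ξ) : False := by
  have h1 := fix_ge_one h hξ2 hi g lam hg
  have h2 := fix_ge_one h hξ2 hi g⁻¹ lam⁻¹ (by
    have := act_inv_act g ξ
    rw [hg, Matrix.mulVec_smul] at this
    rw [← this, smul_smul, inv_mul_cancel₀ (by positivity), one_smul, this])
  have h3 : lam = 1 := by
    apply le_antisymm _ h1
    by_contra hc
    push Not at hc
    have := inv_lt_one_of_one_lt₀ hc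
    linarith
  rw [h3, one_smul] at hg
  obtain ⟨μ, hμ, v, hv, hgv⟩ := hh g hg1
  have b1 : Bform v v = 0 := by
    have := B_act h g v v
    rw [hgv, Bform_smul_left, Bform_smul_right] at this
    have : (μ * μ - 1) * Bform v v = 0 := by linarith
    rcases mul_eq_zero.1 this with h | h
    · nlinarith
    · exact h
  have b2 : Bform v ξ = 0 := by
    have := B_act h g v ξ
    rw [hgv, hg, Bform_smul_left] at this
    have : (μ - 1) * Bform v ξ = 0 := by linarith
    rcases mul_eq_zero.1 this with h | h
    · linarith
    · exact h
  have s := hξ.sq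
  unfold Bform at b1 b2
  rw [hξ2] at b2 s
  have c0 : (v 0 - v 2 * ξ 0) ^ 2 + (v 1 - v 2 * ξ 1) ^ 2 = 0 := by
    linear_combination b1 - 2 * v 2 * b2 + v 2 ^ 2 * s
  have e0 : v 0 = v 2 * ξ 0 := by nlinarith [sq_nonneg (v 0 - v 2 * ξ 0), sq_nonneg (v 1 - v 2 * ξ 1)]
  have e1 : v 1 = v 2 * ξ 1 := by nlinarith [sq_nonneg (v 0 - v 2 * ξ 0), sq_nonneg (v 1 - v 2 * ξ 1)]
  have ev : v = v 2 • ξ := by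
    ext i; fin_cases i
    · simpa using e0
    · simpa using e1
    · simp [hξ2]
  have : toM g *ᵥ v = v := by
    conv_lhs => rw [ev, Matrix.mulVec_smul, hg]
    exact ev.symm
  rw [hgv] at this
  apply hv
  have : (μ - 1) • v = 0 := by rw [sub_smul, this, one_smul, sub_self]
  rcases smul_eq_zero.1 this with h | h
  · linarith
  · exact h

end core


section core2
variable {Γ₀ : Subgroup (Matrix (Fin 3) (Fin 3) ℝ)ˣ}

lemma Det_pq {ξ : Fin 3 → ℝ} (hξ : Nul ξ) (hξ2 : ξ 2 = 1) (x y : Fin 3 → ℝ) :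
    Det3 ξ x y = Dd ξ x * (- Bform ξ y) - (- Bform ξ x) * Dd ξ y := by
  have s := hξ.sq
  rw [hξ2] at s
  simp only [Det3, Dd, Bform, hξ2]
  linear_combination (x 0 * y 1 - x 1 * y 0) * (- s)

lemma Nul_parallel {a b : Fin 3 → ℝ} (ha : Nul a) (hb : Nul b) (hD : Dd a b = 0)
    (s0 : 0 < a 0 ↔ 0 < b 0) (s1 : 0 < a 1 ↔ 0 < b 1) : a = (a 2 / b 2) • b := by
  have qa := ha.sq
  have qb := hb.sq
  have ha2 := ha.2
  have hb2 := hb.2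
  unfold Dd at hD
  have hprod : (a 0 * b 0 + a 1 * b 1) ^ 2 = (a 2 * b 2) ^ 2 := by
    rw [mul_pow, ← qa, ← qb]
    linear_combination (- (a 0 * b 1 - a 1 * b 0)) * hD
  have n0 : 0 ≤ a 0 * b 0 := by
    by_cases h : 0 < a 0
    · exact (mul_pos h (s0.1 h)).le
    · have := not_lt.1 (fun h' => h (s0.2 h'))
      have := not_lt.1 h
      nlinarith
  have n1 : 0 ≤ a 1 * b 1 := by
    by_cases h : 0 < a 1
    · exact (mul_pos h (s1.1 h)).le
    · have := not_lt.1 (fun h' => h (s1.2 h'))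
      have := not_lt.1 h
      nlinarith
  have e : a 0 * b 0 + a 1 * b 1 = a 2 * b 2 := by
    rcases sq_eq_sq_iff_eq_or_eq_neg.1 hprod with h | h
    · exact h
    · nlinarith [mul_pos ha2 hb2]
  have g0 : a 0 * b 2 = a 2 * b 0 := by
    have : b 2 * (a 0 * b 2 - a 2 * b 0) = 0 := by
      linear_combination (-a 0) * qb + b 0 * e + b 1 * hD
    rcases mul_eq_zero.1 this with h | h <;> linarith
  have g1 : a 1 * b 2 = a 2 * b 1 := by
    have : b 2 * (a 1 * b 2 - a 2 * b 1) = 0 := by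
      linear_combination (-a 1) * qb + b 1 * e - b 0 * hD
    rcases mul_eq_zero.1 this with h | h <;> linarith
  ext i
  fin_cases i
  · simp; field_simp; linarith
  · simp; field_simp; linarith
  · simp; field_simp

/-- the horospherical coordinate grows: `q² + 1 = p (2 v₂ - p)` -/
lemma pq_id {ξ v : Fin 3 → ℝ} (hξ : Nul ξ) (hξ2 : ξ 2 = 1) (hv : Hyp v) :
    Dd ξ v ^ 2 + 1 = (- Bform ξ v) * (2 * v 2 - (- Bform ξ v)) := by
  have s := hξ.sq
  have t := hv.sq
  rw [hξ2] at s
  simp only [Dd, Bform, hξ2]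
  linear_combination (v 0 ^ 2 + v 1 ^ 2) * s + t

lemma near_xi {ξ v : Fin 3 → ℝ} (hξ : Nul ξ) (hξ2 : ξ 2 = 1) (hv : Hyp v) :
    (v 0 - v 2 * ξ 0) ^ 2 + (v 1 - v 2 * ξ 1) ^ 2 ≤ 2 * v 2 * (- Bform ξ v) := by
  have s := hξ.sq
  have t := hv.sq
  rw [hξ2] at s
  simp only [Bform, hξ2]
  nlinarith

/-- Linear functional negative at `ξ` is negative at points with large coordinate. -/
lemma neg_near {ξ : Fin 3 → ℝ} (hξ : Nul ξ) (hξ2 : ξ 2 = 1) (l : (Fin 3 → ℝ) →ₗ[ℝ] ℝ)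
    (hl : l ξ < 0) : ∃ T : ℝ, 0 < T ∧ ∀ v, Hyp v → T * (- Bform ξ v) < |Dd ξ v| → l v < 0 := by
  have hdec : ∀ v : Fin 3 → ℝ, l v = v 2 * l ξ + ((v 0 - v 2 * ξ 0) * l ![1,0,0]
      + (v 1 - v 2 * ξ 1) * l ![0,1,0]) := by
    intro v
    have hd : v = v 2 • ξ + ((v 0 - v 2 * ξ 0) • ![1,0,0] + (v 1 - v 2 * ξ 1) • ![0,1,0]) := by
      ext i; fin_cases i <;> simp [hξ2]
    conv_lhs => rw [hd]
    simp only [map_add, map_smul, smul_eq_mul]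
  generalize l ![1,0,0] = L0 at hdec
  generalize l ![0,1,0] = L1 at hdec
  set A := |L0| + |L1| + 1 with hA
  have hApos : 0 < A := by positivity
  refine ⟨2 * A / (- l ξ), by have := neg_pos.2 hl; positivity, ?_⟩
  intro v hv hT
  have hp := hξ.pos hv
  set p := - Bform ξ v with hpdef
  have hid := pq_id hξ hξ2 hv
  rw [← hpdef] at hid
  have hn := near_xi hξ hξ2 hv
  rw [← hpdef] at hn
  have hv2 := hv.2
  have hm := neg_pos.2 hl
  set m := - l ξ with hmdef
  -- (2A/m)^2 p^2 < q^2 < 2 v2 p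
  have h1 : (2 * A / m * p) ^ 2 < Dd ξ v ^ 2 := by
    rw [← sq_abs (Dd ξ v)]
    exact pow_lt_pow_left₀ hT (by positivity) (by norm_num)
  have h2 : (2 * A / m) ^ 2 * p < 2 * v 2 := by
    have : p * ((2 * A / m) ^ 2 * p) < p * (2 * v 2) := by nlinarith
    exact lt_of_mul_lt_mul_left this hp.le
  have h3 : 2 * A ^ 2 * p < m ^ 2 * v 2 := by
    rw [div_pow, div_mul_eq_mul_div, div_lt_iff₀ (by positivity)] at h2
    nlinarith
  rw [hdec]
  generalize v 0 - v 2 * ξ 0 = w0 at hn ⊢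
  generalize v 1 - v 2 * ξ 1 = w1 at hn ⊢
  have hs : (m * v 2) ^ 2 > A ^ 2 * (w0 ^ 2 + w1 ^ 2) := by
    have : A ^ 2 * (w0 ^ 2 + w1 ^ 2) ≤ A ^ 2 * (2 * v 2 * p) := by gcongr
    nlinarith
  have hr : Real.sqrt (w0 ^ 2 + w1 ^ 2) * A < m * v 2 := by
    apply lt_of_pow_lt_pow_left₀ 2 (by positivity)
    rw [mul_pow, Real.sq_sqrt (by positivity)]
    linarith
  have b0 : |w0| ≤ Real.sqrt (w0 ^ 2 + w1 ^ 2) := Real.abs_le_sqrt (by nlinarith)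
  have b1 : |w1| ≤ Real.sqrt (w0 ^ 2 + w1 ^ 2) := Real.abs_le_sqrt (by nlinarith)
  set r := Real.sqrt (w0 ^ 2 + w1 ^ 2)
  have hr0 : 0 ≤ r := Real.sqrt_nonneg _
  have c0 : w0 * L0 ≤ r * |L0| :=
    (le_abs_self _).trans (by rw [abs_mul]; gcongr)
  have c1 : w1 * L1 ≤ r * |L1| :=
    (le_abs_self _).trans (by rw [abs_mul]; gcongr)
  have : l ξ = - m := by simp [hmdef]
  rw [this]
  rw [hA] at hr
  have : r * (|L0| + |L1| + 1) = r * |L0| + r * |L1| + r := by ring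
  linarith

def DdLin (b : Fin 3 → ℝ) (σ : ℝ) (M : Matrix (Fin 3) (Fin 3) ℝ) : (Fin 3 → ℝ) →ₗ[ℝ] ℝ where
  toFun v := σ * Dd b (M *ᵥ v)
  map_add' x y := by simp only [Matrix.mulVec_add, Dd, Pi.add_apply]; ring
  map_smul' t x := by
    simp only [Matrix.mulVec_smul, Dd, Pi.smul_apply, smul_eq_mul, RingHom.id_apply]; ring

lemma qc_core (h : ∀ γ : Γ₀, SO21 (toM γ)) (hd : DiscreteTopology Γ₀)
    (hh : ∀ γ : Γ₀, γ ≠ 1 → IsHyperbolic (toM γ))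
    (S : Set Γ₀) (hSfin : S.Finite) (hSgen : Subgroup.closure S = ⊤)
    {ξ : Fin 3 → ℝ} (hξ : Nul ξ) (hξ2 : ξ 2 = 1)
    (hi : ∀ δ : Γ₀, 1 / 2 ≤ - Bform ξ (orb δ))
    (hii : ∀ M : ℝ, ∃ δ : Γ₀, M * (- Bform ξ (orb δ)) < orb δ 2) : False := by
  -- the horizontal coordinate is unbounded on one side
  have hX : ∃ σ : ℝ, σ ^ 2 = 1 ∧ ∀ T : ℝ, ∃ δ : Γ₀, T < σ * Dd ξ (orb δ) / (- Bform ξ (orb δ)) := by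
    by_contra hc
    push Not at hc
    obtain ⟨T1, hT1⟩ := hc 1 (by norm_num)
    obtain ⟨T2, hT2⟩ := hc (-1) (by norm_num)
    obtain ⟨δ, hδ⟩ := hii (T1 ^ 2 + T2 ^ 2 + 3)
    have hp := hξ.pos (Hyp_orb h δ)
    have a1 := hT1 δ
    have a2 := hT2 δ
    have hid := pq_id hξ hξ2 (Hyp_orb h δ)
    have hp2 := hi δ
    set p := - Bform ξ (orb δ)
    set q := Dd ξ (orb δ)
    rw [div_le_iff₀ hp] at a1 a2
    have q2 : q ^ 2 ≤ (T1 ^ 2 + T2 ^ 2) * p ^ 2 := by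
      rcases le_total 0 q with h0 | h0
      · have : q ^ 2 ≤ (T1 * p) ^ 2 := by
          apply pow_le_pow_left₀ h0; linarith
        nlinarith [sq_nonneg (T2 * p)]
      · have : (-q) ^ 2 ≤ (T2 * p) ^ 2 := by
          apply pow_le_pow_left₀ (by linarith); linarith
        nlinarith [sq_nonneg (T1 * p)]
    nlinarith [mul_lt_mul_of_pos_left hδ hp, sq_nonneg T1, sq_nonneg T2, sq_nonneg p]
  obtain ⟨σ, hσ, hX⟩ := hX
  set p : Γ₀ → ℝ := fun δ => - Bform ξ (orb δ) with hpdef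
  set X : Γ₀ → ℝ := fun δ => σ * Dd ξ (orb δ) / (- Bform ξ (orb δ)) with hXdef
  have hppos : ∀ δ, 0 < p δ := fun δ => hξ.pos (Hyp_orb h δ)
  set A : Set Γ₀ := {γ | ∀ δ, X γ ≤ X δ → p γ ≤ 2 * p δ} with hA
  have hAsel : ∀ T : ℝ, ∃ γ ∈ A, T ≤ X γ := by
    intro T
    set Q : Set ℝ := p '' {δ | T ≤ X δ}
    have hQne : Q.Nonempty := by
      obtain ⟨δ, hδ⟩ := hX T
      exact ⟨p δ, δ, hδ.le, rfl⟩
    have hQb : BddBelow Q := ⟨1/2, by rintro _ ⟨δ, _, rfl⟩; exact hi δ⟩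
    have hI : 1/2 ≤ sInf Q := le_csInf hQne (by rintro _ ⟨δ, _, rfl⟩; exact hi δ)
    obtain ⟨_, ⟨γ, hγ, rfl⟩, hlt⟩ := exists_lt_of_csInf_lt hQne (show sInf Q < 2 * sInf Q by linarith)
    refine ⟨γ, ?_, hγ⟩
    intro δ hδ
    have : sInf Q ≤ p δ := csInf_le hQb ⟨δ, le_trans hγ hδ, rfl⟩
    linarith
  have hAinf : A.Infinite := by
    intro hfin
    obtain ⟨T, hT⟩ := (hfin.image X).bddAbove
    obtain ⟨γ, hγ, h1⟩ := hAsel (T + 1)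
    have := hT ⟨γ, hγ, rfl⟩
    linarith
  -- relation between Dd and X
  have hDX : ∀ γ η : Γ₀, σ * Dd (toM γ⁻¹ *ᵥ ξ) (orb (γ⁻¹ * η)) = p η * p γ * (X η - X γ) := by
    intro γ η
    rw [← Det3_e3, ← Det3_act h γ, orb_mul, act_act_inv, act_act_inv, Det_pq hξ hξ2]
    have h1 := (hppos γ).ne'
    have h2 := (hppos η).ne'
    change σ * (Dd ξ (orb η) * p γ - p η * Dd ξ (orb γ)) =
      p η * p γ * (σ * Dd ξ (orb η) / p η - σ * Dd ξ (orb γ) / p γ)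
    field_simp
  have hBp : ∀ γ δ : Γ₀, - Bform (toM γ⁻¹ *ᵥ ξ) (orb δ) = p (γ * δ) := by
    intro γ δ
    rw [B_act_left h, inv_inv, ← orb_mul]
  have ha2 : ∀ γ : Γ₀, (toM γ⁻¹ *ᵥ ξ) 2 = p γ := by
    intro γ
    have := hBp γ 1
    rw [orb_one, Bform_e3, neg_neg, mul_one] at this
    exact this
  have hP : ∀ γ ∈ A, ∀ δ : Γ₀, 0 ≤ σ * Dd (toM γ⁻¹ *ᵥ ξ) (orb δ) →
      (toM γ⁻¹ *ᵥ ξ) 2 ≤ 2 * (- Bform (toM γ⁻¹ *ᵥ ξ) (orb δ)) := by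
    intro γ hγ δ h0
    rw [hBp, ha2]
    apply hγ
    have := hDX γ (γ * δ)
    rw [inv_mul_cancel_left] at this
    rw [this] at h0
    have := nonneg_of_mul_nonneg_right h0 (mul_pos (hppos _) (hppos _))
    linarith
  -- constants
  obtain ⟨K0, hK0⟩ := (hSfin.image (fun s : Γ₀ => orb s 2)).bddAbove
  set K := max K0 1 with hK
  have hK1 : 1 ≤ K := le_max_right _ _
  have hSK : ∀ s ∈ S, orb s 2 ≤ K := fun s hs => (hK0 ⟨s, hs, rfl⟩).trans (le_max_left _ _)
  have hFfin := finite_orb h hd (8 * K ^ 3)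
  set F : Set Γ₀ := {γ | orb γ 2 ≤ 8 * K ^ 3} with hF
  have : Finite F := hFfin
  have : Infinite A := hAinf.to_subtype
  obtain ⟨⟨γ, hγ⟩, ⟨γ', hγ'⟩, hne, heq⟩ := Finite.exists_ne_map_eq_of_infinite
    (fun γ : A => ((fun w : F => decide (0 < σ * Dd (toM (γ : Γ₀)⁻¹ *ᵥ ξ) (orb (w : Γ₀)))),
      decide (0 < (toM (γ : Γ₀)⁻¹ *ᵥ ξ) 0), decide (0 < (toM (γ : Γ₀)⁻¹ *ᵥ ξ) 1)))
  simp only [Prod.mk.injEq, funext_iff, decide_eq_decide, Subtype.forall] at heq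
  have hneq : γ ≠ γ' := fun h => hne (Subtype.ext h)
  obtain ⟨hs', h0, h1⟩ := heq
  have hs := fun (w : Γ₀) (hw : w ∈ F) => hs' w w.2 hw
  -- main symmetric claim
  have main : ∀ γ ∈ A, ∀ γ' ∈ A,
      (∀ w ∈ F, 0 < σ * Dd (toM γ⁻¹ *ᵥ ξ) (orb w) ↔ 0 < σ * Dd (toM γ'⁻¹ *ᵥ ξ) (orb w)) →
      0 < σ * Dd (toM γ⁻¹ *ᵥ ξ) (toM γ'⁻¹ *ᵥ ξ) → False := by
    intro γ hγ γ' hγ' hs hab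
    set a := toM γ⁻¹ *ᵥ ξ with ha
    set b := toM γ'⁻¹ *ᵥ ξ with hb
    have hna : Nul a := Nul_act h _ hξ
    have hnb : Nul b := Nul_act h _ hξ
    -- a vertex in the cone
    obtain ⟨T, hT0, hT⟩ := neg_near hξ hξ2 (DdLin b σ (toM γ⁻¹)) (by
      show σ * Dd b (toM γ⁻¹ *ᵥ ξ) < 0
      rw [← ha]
      have : Dd b a = - Dd a b := by unfold Dd; ring
      rw [this]; linarith)
    obtain ⟨η, hη⟩ := hX (max T (X γ))
    have hη1 : X γ < X η := lt_of_le_of_lt (le_max_right _ _) hη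
    have hη2 : T < X η := lt_of_le_of_lt (le_max_left _ _) hη
    have hstart : 0 < σ * Dd a (orb (γ⁻¹ * η)) ∧ σ * Dd b (orb (γ⁻¹ * η)) < 0 := by
      constructor
      · rw [hDX]
        exact mul_pos (mul_pos (hppos _) (hppos _)) (by linarith)
      · rw [orb_mul]
        refine hT (orb η) (Hyp_orb h η) ?_
        have h2 := hppos η
        have h3 : T * p η < σ * Dd ξ (orb η) := by
          rwa [hXdef, lt_div_iff₀ h2] at hη2
        refine h3.trans_le ((le_abs_self _).trans ?_)
        rw [abs_mul]
        have : |σ| = 1 := by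
          rw [← sq_abs] at hσ; nlinarith [abs_nonneg σ]
        rw [this, one_mul]
    have step : ∀ δ s : Γ₀, orb s 2 ≤ K → (0 < σ * Dd a (orb δ) ∧ σ * Dd b (orb δ) < 0) →
        (0 < σ * Dd a (orb (δ * s)) ∧ σ * Dd b (orb (δ * s)) < 0) := by
      intro δ s hsK hδ
      by_contra hc
      have hle := exit_lemma hK1 hna hnb (Hyp_orb h δ) (Hyp_orb h (δ * s))
        (by rw [B_orb h, inv_mul_cancel_left]; exact hsK) hab hδ.1 hδ.2 hc
        (hP γ hγ _) (hP γ' hγ' _)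
      have := (hs δ hle).1 hδ.1
      linarith [hδ.2]
    have all : ∀ g ∈ Subgroup.closure S, ∀ δ : Γ₀,
        (0 < σ * Dd a (orb δ) ∧ σ * Dd b (orb δ) < 0) →
        (0 < σ * Dd a (orb (δ * g)) ∧ σ * Dd b (orb (δ * g)) < 0) := by
      intro g hg
      induction hg using Subgroup.closure_induction'' with
      | mem x hx => intro δ; exact step δ x (hSK x hx)
      | inv_mem x hx => intro δ; exact step δ x⁻¹ (by rw [orb_inv_two h]; exact hSK x hx)
      | one => intro δ; simp
      | mul x y _ _ ihx ihy => intro δ hδ; rw [← mul_assoc]; exact ihy _ (ihx _ hδ)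
    have := (all (γ⁻¹ * η)⁻¹ (by rw [hSgen]; trivial) _ hstart).1
    rw [mul_inv_cancel, orb_one] at this
    simp [Dd, e3] at this
  have hna : Nul (toM γ⁻¹ *ᵥ ξ) := Nul_act h _ hξ
  have hnb : Nul (toM γ'⁻¹ *ᵥ ξ) := Nul_act h _ hξ
  have hσ0 : σ ≠ 0 := by rintro rfl; norm_num at hσ
  have hDne : Dd (toM γ⁻¹ *ᵥ ξ) (toM γ'⁻¹ *ᵥ ξ) ≠ 0 := by
    intro hD
    have hpar := Nul_parallel hna hnb hD h0 h1
    refine no_fix h hh hξ hξ2 hi (γ' * γ⁻¹) ?_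
      ((toM γ⁻¹ *ᵥ ξ) 2 / (toM γ'⁻¹ *ᵥ ξ) 2) ?_
    · intro h1; exact hneq (mul_inv_eq_one.1 h1).symm
    · rw [act_mul]
      conv_lhs => rw [hpar]
      rw [Matrix.mulVec_smul, act_act_inv]
  have hDne' := mul_ne_zero hσ0 hDne
  rcases lt_or_gt_of_ne hDne' with hlt | hgt
  · apply main γ' hγ' γ hγ (fun w hw => (hs w hw).symm)
    have : Dd (toM γ'⁻¹ *ᵥ ξ) (toM γ⁻¹ *ᵥ ξ) = - Dd (toM γ⁻¹ *ᵥ ξ) (toM γ'⁻¹ *ᵥ ξ) := by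
      unfold Dd; ring
    rw [this]; linarith
  · exact main γ hγ γ' hγ' hs hgt

end core2


section qcsec
variable {Γ₀ : Subgroup (Matrix (Fin 3) (Fin 3) ℝ)ˣ}

lemma qc_seq (h : ∀ γ : Γ₀, SO21 (toM γ)) {k : ℝ}
    {γ : Γ₀} {α β : ℝ} (hα : 0 ≤ α) (hβ : 0 ≤ β) (hp : Hyp (α • e3 + β • orb γ))
    (hk : ∀ δ : Γ₀, k < - Bform (α • e3 + β • orb γ) (orb δ)) :
    ∃ (p : Fin 3 → ℝ) (a b : Γ₀) (α β : ℝ), 0 ≤ α ∧ 0 ≤ β ∧ p = α • orb a + β • orb b ∧ Hyp p ∧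
      k < p 2 ∧ ∀ δ : Γ₀, p 2 ≤ 2 * (- Bform p (orb δ)) := by
  set p := α • e3 + β • orb γ with hpdef
  set f : Γ₀ → ℝ := fun δ => - Bform p (orb δ) with hf
  have hb : ∀ δ, 1 ≤ f δ := fun δ => hp.one_le_B (Hyp_orb h δ)
  have hbdd : BddBelow (Set.range f) := ⟨1, by rintro _ ⟨δ, rfl⟩; exact hb δ⟩
  have hinf1 : 1 ≤ iInf f := le_ciInf hb
  obtain ⟨δ, hδ⟩ := exists_lt_of_ciInf_lt (show iInf f < 2 * iInf f by linarith)
  refine ⟨toM δ⁻¹ *ᵥ p, δ⁻¹, δ⁻¹ * γ, α, β, hα, hβ, ?_, Hyp_act h _ hp, ?_, ?_⟩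
  · rw [hpdef, Matrix.mulVec_add, Matrix.mulVec_smul, Matrix.mulVec_smul, orb_mul]; rfl
  · have := hk δ
    rw [orb, Bform_comm, B_act_left h, Bform_e3'] at this; linarith
  · intro δ'
    have h1 : (toM δ⁻¹ *ᵥ p) 2 = f δ := by
      simp only [hf]; rw [orb, Bform_comm, B_act_left h, Bform_e3', neg_neg]
    have h2 : - Bform (toM δ⁻¹ *ᵥ p) (orb δ') = f (δ * δ') := by
      simp only [hf]; rw [B_act_left h, inv_inv, orb_mul]
    rw [h1, h2]
    have := ciInf_le hbdd (δ * δ')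
    linarith

lemma cont_B (w : Fin 3 → ℝ) : Continuous fun x => Bform x w := by
  unfold Bform; fun_prop

lemma qc (h : ∀ γ : Γ₀, SO21 (toM γ)) (hd : DiscreteTopology Γ₀)
    (hh : ∀ γ : Γ₀, γ ≠ 1 → IsHyperbolic (toM γ))
    (S : Set Γ₀) (hSfin : S.Finite) (hSgen : Subgroup.closure S = ⊤) :
    ∃ C : ℝ, 1 ≤ C ∧ ∀ (γ : Γ₀) (α β : ℝ), 0 ≤ α → 0 ≤ β → Hyp (α • e3 + β • orb γ) →
      ∃ δ : Γ₀, - Bform (α • e3 + β • orb γ) (orb δ) ≤ C := by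
  by_contra hc
  push Not at hc
  have step : ∀ k : ℕ, ∃ (p : Fin 3 → ℝ) (a b : Γ₀) (α β : ℝ), 0 ≤ α ∧ 0 ≤ β ∧
      p = α • orb a + β • orb b ∧ Hyp p ∧
      (k : ℝ) + 1 < p 2 ∧ ∀ δ : Γ₀, p 2 ≤ 2 * (- Bform p (orb δ)) := by
    intro k
    obtain ⟨γ, α, β, hα, hβ, hp, hk⟩ := hc ((k : ℝ) + 1) (by linarith [Nat.cast_nonneg (α := ℝ) k])
    exact qc_seq h hα hβ hp hk
  choose p a b α β hα hβ hpe hp hpk hpm using step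
  have hp0 : ∀ k, 0 < p k 2 := fun k => (hp k).2
  set x : ℕ → Fin 3 → ℝ := fun k => (p k 2)⁻¹ • p k with hx
  have hxK : ∀ k, x k ∈ Set.Icc (-1 : Fin 3 → ℝ) 1 := by
    intro k
    have hb : ∀ i, |x k i| ≤ 1 := by
      intro i
      simp only [hx, Pi.smul_apply, smul_eq_mul, abs_mul, abs_inv, abs_of_pos (hp0 k)]
      rw [inv_mul_le_iff₀ (hp0 k), mul_one]
      fin_cases i
      · exact (hp k).abs0
      · exact (hp k).abs1
      · exact (abs_of_pos (hp0 k)).le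
    exact ⟨fun i => (abs_le.1 (hb i)).1, fun i => (abs_le.1 (hb i)).2⟩
  obtain ⟨ξ, -, φ, hφ, hlim⟩ := isCompact_Icc.tendsto_subseq hxK
  have hx2 : ∀ k, x k 2 = 1 := fun k => by
    simp only [hx, Pi.smul_apply, smul_eq_mul]; exact inv_mul_cancel₀ (hp0 k).ne'
  have hξ2 : ξ 2 = 1 := by
    have h1 : Filter.Tendsto (fun k => (x ∘ φ) k 2) Filter.atTop (nhds (ξ 2)) :=
      ((continuous_apply 2).tendsto ξ).comp hlim
    have h2 : (fun k => (x ∘ φ) k 2) = fun _ => 1 := by funext k; exact hx2 _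
    rw [h2] at h1
    exact tendsto_nhds_unique h1 tendsto_const_nhds |>.symm ▸ rfl
  have hBx : ∀ k, Bform (x k) (x k) = - ((p k 2)⁻¹) ^ 2 := fun k => by
    simp only [hx]; rw [Bform_smul_left, Bform_smul_right, (hp k).1]; ring
  have hξ0 : Bform ξ ξ = 0 := by
    have hc : Continuous fun x : Fin 3 → ℝ => Bform x x := by unfold Bform; fun_prop
    have h1 : Filter.Tendsto (fun k => Bform ((x ∘ φ) k) ((x ∘ φ) k)) Filter.atTop
        (nhds (Bform ξ ξ)) := (hc.tendsto ξ).comp hlim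
    have h2 : Filter.Tendsto (fun k => (p k 2)) Filter.atTop Filter.atTop :=
      Filter.tendsto_atTop_mono (fun k => (show (k : ℝ) ≤ p k 2 by linarith [hpk k]))
        tendsto_natCast_atTop_atTop
    have h3 : Filter.Tendsto (fun k => - ((p k 2)⁻¹) ^ 2) Filter.atTop (nhds (-(0 ^ 2))) :=
      ((tendsto_inv_atTop_zero.comp h2).pow 2).neg
    have h4 := h3.comp hφ.tendsto_atTop
    have h5 : (fun k => Bform ((x ∘ φ) k) ((x ∘ φ) k)) = (fun k => - ((p k 2)⁻¹) ^ 2) ∘ φ := by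
      funext k; exact hBx _
    rw [h5] at h1
    simpa using tendsto_nhds_unique h1 h4
  have hi : ∀ δ : Γ₀, 1 / 2 ≤ - Bform ξ (orb δ) := by
    intro δ
    have h1 : Filter.Tendsto (fun k => - Bform ((x ∘ φ) k) (orb δ)) Filter.atTop
        (nhds (- Bform ξ (orb δ))) := (((cont_B (orb δ)).tendsto ξ).comp hlim).neg
    refine ge_of_tendsto' h1 fun k => ?_
    simp only [hx, Function.comp]
    rw [Bform_smul_left, ← mul_neg, le_inv_mul_iff₀ (hp0 _)]
    linarith [hpm (φ k) δ]
  refine qc_core h hd hh S hSfin hSgen ⟨hξ0, by rw [hξ2]; norm_num⟩ hξ2 hi ?_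
  intro M
  set M' := |M| + 1 with hM'
  have hM'0 : 0 < M' := by positivity
  have h1 : Filter.Tendsto (fun k => - Bform ((x ∘ φ) k) ξ) Filter.atTop
        (nhds (- Bform ξ ξ)) := (((cont_B ξ).tendsto ξ).comp hlim).neg
  rw [hξ0, neg_zero] at h1
  obtain ⟨k, hk⟩ := (h1.eventually (gt_mem_nhds (show (0:ℝ) < 1 / M' by positivity))).exists
  set j := φ k
  have hk2 : M' * (- Bform (p j) ξ) < p j 2 := by
    have : - Bform (x j) ξ < 1 / M' := hk
    simp only [hx] at this
    rw [Bform_smul_left, ← mul_neg, inv_mul_lt_iff₀ (hp0 j), mul_one_div, lt_div_iff₀ hM'0] at this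
    linarith
  rw [hpe j, Bform_add_left, Bform_smul_left, Bform_smul_left, Bform_comm _ ξ, Bform_comm _ ξ] at hk2
  simp only [Pi.add_apply, Pi.smul_apply, smul_eq_mul] at hk2
  have hMM : ∀ δ : Γ₀, M * (- Bform ξ (orb δ)) ≤ M' * (- Bform ξ (orb δ)) := fun δ =>
    mul_le_mul_of_nonneg_right (by rw [hM']; linarith [le_abs_self M]) (by linarith [hi δ])
  by_contra hno
  push Not at hno
  have e1 := mul_le_mul_of_nonneg_left ((hno (a j)).trans (hMM _)) (hα j)
  have e2 := mul_le_mul_of_nonneg_left ((hno (b j)).trans (hMM _)) (hβ j)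
  nlinarith

end qcsec


section chainsec
variable {Γ₀ : Subgroup (Matrix (Fin 3) (Fin 3) ℝ)ˣ}

lemma polar {x : Fin 3 → ℝ} (hx : Hyp x) : ∃ (a b d : ℝ), a ^ 2 + b ^ 2 = 1 ∧ 0 ≤ d ∧
    x = ![Real.sinh d * a, Real.sinh d * b, Real.cosh d] := by
  have hs := hx.sq
  have h1 := hx.one_le
  set r := Real.sqrt (x 2 ^ 2 - 1) with hr
  have hr2 : r ^ 2 = x 2 ^ 2 - 1 := Real.sq_sqrt (by nlinarith)
  have hr0 : 0 ≤ r := Real.sqrt_nonneg _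
  have hc : Real.cosh (Real.arsinh r) = x 2 := by
    have e1 := Real.cosh_sq (Real.arsinh r)
    rw [Real.sinh_arsinh] at e1
    have e2 := Real.cosh_pos (Real.arsinh r)
    have : Real.cosh (Real.arsinh r) ^ 2 = x 2 ^ 2 := by linarith
    nlinarith [sq_eq_sq₀ e2.le hx.2.le |>.1 this]
  rcases hr0.eq_or_lt with h0 | hpos
  · refine ⟨1, 0, 0, by norm_num, le_rfl, ?_⟩
    have h00 : x 0 = 0 := by
      have : x 0 ^ 2 = 0 := by nlinarith [sq_nonneg (x 0), sq_nonneg (x 1)]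
      exact pow_eq_zero_iff (two_ne_zero) |>.1 this
    have h01 : x 1 = 0 := by
      have : x 1 ^ 2 = 0 := by nlinarith [sq_nonneg (x 0), sq_nonneg (x 1)]
      exact pow_eq_zero_iff (two_ne_zero) |>.1 this
    rw [← h0] at hc
    simp at hc
    ext i; fin_cases i
    · simp [h00]
    · simp [h01]
    · simp [← hc]
  · refine ⟨x 0 / r, x 1 / r, Real.arsinh r, ?_, Real.arsinh_nonneg_iff.2 hr0, ?_⟩
    · rw [div_pow, div_pow, ← add_div, div_eq_one_iff_eq (by positivity)]; linarith
    · rw [Real.sinh_arsinh, hc, mul_div_cancel₀ _ hpos.ne', mul_div_cancel₀ _ hpos.ne']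
      ext i; fin_cases i <;> rfl

lemma perp_bound {p x N : Fin 3 → ℝ} (hp : Hyp p) (hx : Hyp x) (hN : Bform N N = 1)
    (hpN : Bform p N = 0) {C : ℝ} (hC : - Bform p x ≤ C) : |Bform N x| ≤ C := by
  have hg := gram p x N
  rw [hp.1, hx.1, hN, hpN] at hg
  have h1 := hp.one_le_B hx
  rw [Bform_comm N x]
  exact abs_le_of_sq_le_sq (by nlinarith [sq_nonneg (Det3 p x N)]) (by linarith)

lemma cosh_le_exp {t : ℝ} (ht : 0 ≤ t) : Real.cosh t ≤ Real.exp t := by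
  rw [Real.cosh_eq]
  have := Real.exp_le_exp.2 (show -t ≤ t by linarith)
  linarith

lemma exp_le_cosh (t : ℝ) : Real.exp t ≤ 2 * Real.cosh t := by
  rw [Real.cosh_eq]
  have := Real.exp_pos (-t)
  linarith

lemma chain (h : ∀ γ : Γ₀, SO21 (toM γ)) (hd : DiscreteTopology Γ₀)
    (hh : ∀ γ : Γ₀, γ ≠ 1 → IsHyperbolic (toM γ))
    (S : Set Γ₀) (hSfin : S.Finite) (hSgen : Subgroup.closure S = ⊤) :
    ∃ C : ℝ, 1 ≤ C ∧ ∀ γ : Γ₀, ∃ (N : Fin 3 → ℝ) (n : ℕ) (g : ℕ → Γ₀),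
      g 0 = 1 ∧ g n = γ ∧ Bform N N = 1 ∧ Bform N e3 = 0 ∧ Bform N (orb γ) = 0 ∧
      (∀ i, |Bform N (orb (g i))| ≤ C) ∧ (∀ i, orb ((g i)⁻¹ * g (i + 1)) 2 ≤ C) ∧
      (∀ i, orb (g i) 2 ≤ C * Real.exp i) ∧
      (∀ i k : ℕ, i + k ≤ n → Real.exp k ≤ C * orb ((g i)⁻¹ * g (i + k)) 2) := by
  obtain ⟨C, hC1, hC⟩ := qc h hd hh S hSfin hSgen
  have hE : Real.exp 1 ≤ 3 := by linarith [Real.exp_one_lt_d9]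
  refine ⟨24 * C ^ 2, by nlinarith, fun γ => ?_⟩
  obtain ⟨a, b, d, hab, hd0, hx⟩ := polar (Hyp_orb h γ)
  set P : ℝ → Fin 3 → ℝ := fun t => ![Real.sinh t * a, Real.sinh t * b, Real.cosh t] with hP
  have hBP : ∀ s t, - Bform (P s) (P t) = Real.cosh (s - t) := by
    intro s t
    rw [Real.cosh_sub]; simp [Bform, hP]
    linear_combination (Real.sinh s * Real.sinh t) * hab
  have hPH : ∀ t, Hyp (P t) := by
    intro t
    refine ⟨?_, ?_⟩
    · have := hBP t t; rw [sub_self, Real.cosh_zero] at this; linarith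
    · simp [hP, Real.cosh_pos]
  have hP0 : P 0 = e3 := by simp [hP, e3]
  have hPd : P d = orb γ := hx.symm
  -- near points
  have hnear : ∀ t, 0 ≤ t → t ≤ d → ∃ δ : Γ₀, - Bform (P t) (orb δ) ≤ C := by
    intro t ht0 htd
    rcases hd0.eq_or_lt with h0 | hpos
    · have : t = 0 := by linarith
      refine ⟨1, ?_⟩
      rw [orb_one, ← hP0, hBP, this]; simpa using hC1
    · have hs : 0 < Real.sinh d := Real.sinh_pos_iff.2 hpos
      have hcomb : P t = (Real.sinh (d - t) / Real.sinh d) • e3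
          + (Real.sinh t / Real.sinh d) • orb γ := by
        rw [← hPd, ← hP0]
        ext i; fin_cases i
        · simp [hP]; field_simp
        · simp [hP]; field_simp
        · simp [hP]; field_simp; rw [Real.sinh_sub]; ring
      rw [hcomb]
      refine hC γ _ _ ?_ ?_ ?_
      · exact div_nonneg (Real.sinh_nonneg_iff.2 (by linarith)) hs.le
      · exact div_nonneg (Real.sinh_nonneg_iff.2 ht0) hs.le
      · rw [← hcomb]; exact hPH t
  set n := ⌊d⌋₊ + 1 with hn
  have hdn : d < n := by rw [hn]; push_cast; exact Nat.lt_floor_add_one d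
  have hnd : (n : ℝ) ≤ d + 1 := by rw [hn]; push_cast; linarith [Nat.floor_le hd0]
  set τ : ℕ → ℝ := fun i => min (i : ℝ) d with hτ
  have hτ0 : ∀ i, 0 ≤ τ i := fun i => le_min (Nat.cast_nonneg i) hd0
  have hτd : ∀ i, τ i ≤ d := fun i => min_le_right _ _
  have hτi : ∀ i : ℕ, τ i ≤ i := fun i => min_le_left _ _
  have hτs : ∀ i : ℕ, |τ i - τ (i + 1)| ≤ 1 := by
    intro i
    simp only [hτ]; push_cast
    rw [abs_le]
    constructor
    · rcases min_cases (i : ℝ) d with h1 | h1 <;> rcases min_cases ((i : ℝ) + 1) d with h2 | h2 <;> linarith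
    · rcases min_cases (i : ℝ) d with h1 | h1 <;> rcases min_cases ((i : ℝ) + 1) d with h2 | h2 <;> linarith
  have hτl : ∀ i k : ℕ, i + k ≤ n → (k : ℝ) - 1 ≤ τ (i + k) - τ i := by
    intro i k hik
    have hik' : (i : ℝ) + k ≤ n := by exact_mod_cast hik
    simp only [hτ]; push_cast
    rcases min_cases (i : ℝ) d with h1 | h1 <;> rcases min_cases ((i : ℝ) + k) d with h2 | h2 <;> linarith
  have hg : ∀ i : ℕ, ∃ δ : Γ₀, - Bform (P (τ i)) (orb δ) ≤ C ∧ (i = 0 → δ = 1) ∧ (i = n → δ = γ) := by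
    intro i
    by_cases h0 : i = 0
    · refine ⟨1, ?_, fun _ => rfl, fun h1 => ?_⟩
      · rw [orb_one, ← hP0, hBP, h0]
        have : τ 0 = 0 := by simp only [hτ]; push_cast; exact min_eq_left hd0
        rw [this]; simpa using hC1
      · omega
    · by_cases h1 : i = n
      · refine ⟨γ, ?_, fun h2 => absurd h2 h0, fun _ => rfl⟩
        have : τ i = d := by simp only [hτ]; rw [h1]; exact min_eq_right hdn.le
        rw [this, ← hPd, hBP]; simpa using hC1
      · obtain ⟨δ, hδ⟩ := hnear (τ i) (hτ0 i) (hτd i)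
        exact ⟨δ, hδ, fun h2 => absurd h2 h0, fun h2 => absurd h2 h1⟩
  choose g hgC hg0 hgn using hg
  have hBN : ∀ t, Bform (P t) ![-b, a, 0] = 0 := by
    intro t; simp [Bform, hP]; ring
  have hNN : Bform ![-b, a, 0] ![-b, a, 0] = 1 := by
    simp [Bform]; linarith
  have hO := fun i => Hyp_orb h (g i)
  refine ⟨![-b, a, 0], n, g, hg0 0 rfl, hgn n rfl, hNN, ?_, ?_, ?_, ?_, ?_, ?_⟩
  · rw [Bform_comm, ← hP0]; exact hBN 0
  · rw [Bform_comm, ← hPd]; exact hBN d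
  · intro i
    refine (perp_bound (hPH (τ i)) (hO i) hNN (hBN _) (hgC i)).trans (by nlinarith)
  · intro i
    rw [← B_orb h]
    have t1 := tri (hO i) (hPH (τ i)) (hO (i+1))
    have t2 := tri (hPH (τ i)) (hPH (τ (i+1))) (hO (i+1))
    rw [hBP] at t2
    have hc : Real.cosh (τ i - τ (i+1)) ≤ 3 := by
      rw [← Real.cosh_abs]
      exact (cosh_le_exp (abs_nonneg _)).trans ((Real.exp_le_exp.2 (hτs i)).trans hE)
    have c1 := hgC i
    have c2 := hgC (i+1)
    rw [Bform_comm (orb (g i)) (P (τ i))] at t1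
    have p1 := (hPH (τ i)).one_le_B (hO i)
    have p2 := (hPH (τ (i+1))).one_le_B (hO (i+1))
    have p3 := (hPH (τ i)).one_le_B (hO (i+1))
    have c3 : - Bform (P (τ i)) (orb (g (i+1))) ≤ 6 * C := by
      have := mul_le_mul hc c2 (by linarith) (by norm_num)
      nlinarith
    have := mul_le_mul c1 c3 (by linarith) (by linarith)
    nlinarith
  · intro i
    have t1 := tri Hyp_e3 (hPH (τ i)) (hO i)
    rw [← hP0, hBP, hP0, Bform_e3', neg_neg, zero_sub, Real.cosh_neg] at t1
    have c0 := (cosh_le_exp (hτ0 i)).trans (Real.exp_le_exp.2 (hτi i))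
    have c1 := hgC i
    have p1 := (hPH (τ i)).one_le_B (hO i)
    have hep := Real.exp_pos (i : ℝ)
    have := mul_le_mul c0 c1 (by linarith) hep.le
    have hh2 : 2 * (Real.exp i * C) ≤ 24 * C ^ 2 * Real.exp i := by
      have : 2 * C ≤ 24 * C ^ 2 := by nlinarith
      nlinarith
    linarith
  · intro i k hik
    rw [← B_orb h]
    have t1 := tri (hPH (τ i)) (hO i) (hPH (τ (i + k)))
    have t2 := tri (hO i) (hO (i+k)) (hPH (τ (i + k)))
    rw [hBP] at t1
    have c1 := hgC i
    have c2 := hgC (i+k)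
    rw [Bform_comm (orb (g (i+k))) (P (τ (i+k)))] at t2
    have p1 := (hPH (τ i)).one_le_B (hO i)
    have p2 := (hPH (τ (i+k))).one_le_B (hO (i+k))
    have p3 := (hO i).one_le_B (hO (i+k))
    have p4 := (hO i).one_le_B (hPH (τ (i+k)))
    have e1 : Real.exp (τ (i+k) - τ i) ≤ 2 * Real.cosh (τ i - τ (i+k)) := by
      have := exp_le_cosh (τ (i+k) - τ i)
      rwa [← Real.cosh_neg, neg_sub] at this
    have e2 : Real.exp k ≤ 3 * Real.exp (τ (i+k) - τ i) := by
      have : Real.exp k ≤ Real.exp (1 + (τ (i+k) - τ i)) :=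
        Real.exp_le_exp.2 (by linarith [hτl i k hik])
      rw [Real.exp_add] at this
      have := mul_le_mul_of_nonneg_right hE (Real.exp_pos (τ (i+k) - τ i)).le
      linarith
    set O := - Bform (orb (g i)) (orb (g (i+k)))
    have s2 : - Bform (orb (g i)) (P (τ (i+k))) ≤ 2 * O * C :=
      t2.trans (mul_le_mul_of_nonneg_left c2 (by linarith))
    have s1 := mul_le_mul c1 s2 (by linarith) (by linarith)
    nlinarith

end chainsec


section affsec
variable {Γ₀ : Subgroup (Matrix (Fin 3) (Fin 3) ℝ)ˣ}

lemma coc_one {u : Γ₀ → Fin 3 → ℝ} (hu : IsCocycle Γ₀ u) : u 1 = 0 := by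
  have := hu 1 1
  rw [act_one, mul_one] at this
  exact left_eq_add.1 this

lemma coc_inv {u : Γ₀ → Fin 3 → ℝ} (hu : IsCocycle Γ₀ u) (γ : Γ₀) :
    u γ⁻¹ = - (toM γ⁻¹ *ᵥ u γ) := by
  have := hu γ⁻¹ γ
  rw [inv_mul_cancel, coc_one hu] at this
  exact eq_neg_of_add_eq_zero_left this.symm

lemma Bform_neg_left (a b : Fin 3 → ℝ) : Bform (-a) b = - Bform a b := by
  simp only [Bform, Pi.neg_apply]; ring

lemma fin_bound {ι : Type*} {F : Set ι} (hF : F.Finite) (f : ι → ℝ) :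
    ∃ M : ℝ, 0 ≤ M ∧ ∀ s ∈ F, f s ≤ M := by
  obtain ⟨M, hM⟩ := (hF.image f).bddAbove
  exact ⟨max M 0, le_max_right _ _, fun s hs => (hM ⟨s, hs, rfl⟩).trans (le_max_left _ _)⟩

lemma growth (h : ∀ γ : Γ₀, SO21 (toM γ)) (hd : DiscreteTopology Γ₀)
    (hh : ∀ γ : Γ₀, γ ≠ 1 → IsHyperbolic (toM γ))
    (S : Set Γ₀) (hSfin : S.Finite) (hSgen : Subgroup.closure S = ⊤)
    {u : Γ₀ → Fin 3 → ℝ} (hu : IsCocycle Γ₀ u) :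
    ∃ D : ℝ, 0 ≤ D ∧ ∀ γ : Γ₀, |Bform (u γ) e3| ≤ D * orb γ 2 ∧
      |Bform (u γ) (orb γ)| ≤ D * orb γ 2 := by
  obtain ⟨C, hC1, hC⟩ := chain h hd hh S hSfin hSgen
  obtain ⟨M, hM0, hM⟩ := fin_bound (finite_orb h hd C) (fun s => nm (u s))
  have key : ∀ γ : Γ₀, |Bform (u γ) e3| ≤ M * C * C * orb γ 2 := by
    intro γ
    obtain ⟨N, n, g, hg0, hgn, -, -, -, -, hs, hup, hlow⟩ := hC γ
    have ind : ∀ k : ℕ, |Bform (u (g k)) e3| ≤ M * C * Real.exp k := by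
      intro k
      induction k with
      | zero =>
        rw [hg0, coc_one hu, Bform_e3]
        simp only [Pi.zero_apply, neg_zero, abs_zero]
        positivity
      | succ k ih =>
        have e1 : u (g (k + 1)) = u (g k) + toM (g k) *ᵥ u ((g k)⁻¹ * g (k + 1)) := by
          rw [← hu, mul_inv_cancel_left]
        rw [e1, Bform_add_left, B_act_left h]
        have e2 := (Hyp_orb h (g k)⁻¹).B_le (u ((g k)⁻¹ * g (k + 1)))
        rw [orb_inv_two h] at e2
        have e3' : nm (u ((g k)⁻¹ * g (k + 1))) * orb (g k) 2 ≤ M * (C * Real.exp k) :=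
          mul_le_mul (hM _ (hs k)) (hup k) (Hyp_orb h _).2.le hM0
        have e4 : 2 * Real.exp k ≤ Real.exp ((k + 1 : ℕ) : ℝ) := by
          push_cast
          rw [Real.exp_add]
          nlinarith [Real.exp_one_gt_d9, Real.exp_pos (k : ℝ)]
        have e5 := abs_add_le (Bform (u (g k)) e3) (Bform (u ((g k)⁻¹ * g (k + 1))) (toM (g k)⁻¹ *ᵥ e3))
        have e6 := mul_le_mul_of_nonneg_left e4 (show 0 ≤ M * C by positivity)
        simp only [orb] at e2
        simp only [orb] at e3'
        linarith
    have h1 := ind n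
    have h2 := hlow 0 n (by omega)
    rw [hg0, zero_add, hgn, inv_one, one_mul] at h2
    rw [hgn] at h1
    have := mul_le_mul_of_nonneg_left h2 (show 0 ≤ M * C by positivity)
    linarith
  refine ⟨M * C * C, by positivity, fun γ => ⟨key γ, ?_⟩⟩
  have h1 := key γ⁻¹
  rw [coc_inv hu, Bform_neg_left, abs_neg, orb_inv_two h, B_act_left h, inv_inv] at h1
  exact h1

set_option maxHeartbeats 1000000 in
lemma claimA_alg {x u w : Fin 3 → ℝ} {C D R : ℝ} (hx : Hyp x) (hC : 1 ≤ C) (hD : 0 ≤ D)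
    (hR : 0 ≤ R) (hc : 1 + 3 * C ^ 2 ≤ x 2)
    (hu1 : |Bform u e3| ≤ D * x 2) (hu2 : |Bform u x| ≤ D * x 2)
    (hw : Bform w w = 1) (hw1 : |Bform w e3| ≤ C) (hw2 : |Bform w x| ≤ C)
    (hR' : |Bform u w| ≤ R) :
    ∃ (y : Fin 3 → ℝ) (β : ℝ), u = y + β • x ∧ |β| ≤ 2 * D ∧
      ∀ i, |y i| ≤ 2 * (R + 4 * D * C) + 2 * D := by
  have hsq := hx.sq
  obtain ⟨c, hcdef⟩ : ∃ c, c = x 2 := ⟨_, rfl⟩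
  rw [← hcdef] at hsq hc hu1 hu2
  have hC2 : 1 ≤ C ^ 2 := one_le_pow₀ hC
  have hc2 : 2 ≤ c := by linarith
  have hq : 0 < c ^ 2 - 1 := by
    have := mul_le_mul hc2 hc2 (by norm_num) (by linarith)
    linarith
  obtain ⟨p, hp⟩ : ∃ p, p = Bform u e3 := ⟨_, rfl⟩
  obtain ⟨q, hq'⟩ : ∃ q, q = Bform u x := ⟨_, rfl⟩
  obtain ⟨A, hA⟩ : ∃ A, A = Bform w e3 := ⟨_, rfl⟩
  obtain ⟨A', hA'⟩ : ∃ A', A' = Bform w x := ⟨_, rfl⟩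
  rw [← hp] at hu1
  rw [← hq'] at hu2
  rw [← hA] at hw1
  rw [← hA'] at hw2
  obtain ⟨m, hm⟩ : ∃ z, z = (u 1 * x 0 - u 0 * x 1) / (c ^ 2 - 1) := ⟨_, rfl⟩
  obtain ⟨κ, hκ⟩ : ∃ z, z = (w 1 * x 0 - w 0 * x 1) / (c ^ 2 - 1) := ⟨_, rfl⟩
  obtain ⟨α, hα⟩ : ∃ z, z = (p - c * q) / (c ^ 2 - 1) := ⟨_, rfl⟩
  obtain ⟨β, hβ⟩ : ∃ z, z = (q - c * p) / (c ^ 2 - 1) := ⟨_, rfl⟩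
  have hm' : m * (c ^ 2 - 1) = u 1 * x 0 - u 0 * x 1 := by rw [hm]; exact div_mul_cancel₀ _ hq.ne'
  have hκ' : κ * (c ^ 2 - 1) = w 1 * x 0 - w 0 * x 1 := by rw [hκ]; exact div_mul_cancel₀ _ hq.ne'
  have hα' : α * (c ^ 2 - 1) = p - c * q := by rw [hα]; exact div_mul_cancel₀ _ hq.ne'
  have hβ' : β * (c ^ 2 - 1) = q - c * p := by rw [hβ]; exact div_mul_cancel₀ _ hq.ne'
  have hp2 : p = - u 2 := by rw [hp]; exact Bform_e3 u
  have hA2 : A = - w 2 := by rw [hA]; exact Bform_e3 w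
  have hq2 : q = u 0 * x 0 + u 1 * x 1 - u 2 * c := by rw [hq', hcdef]; rfl
  have hA'2 : A' = w 0 * x 0 + w 1 * x 1 - w 2 * c := by rw [hA', hcdef]; rfl
  have small : ∀ s t : ℝ, |s| ≤ D * c → |t| ≤ D * c → |(s - c * t) / (c ^ 2 - 1)| ≤ 2 * D := by
    intro s t hs ht
    rw [abs_div, abs_of_pos hq, div_le_iff₀ hq]
    have h1 : |s - c * t| ≤ |s| + c * |t| := by
      refine (abs_sub _ _).trans ?_
      rw [abs_mul, abs_of_pos (show 0 < c by linarith)]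
    have h2 : c * |t| ≤ c * (D * c) := mul_le_mul_of_nonneg_left ht (by linarith)
    have h3 : D * c + c * (D * c) ≤ 2 * D * (c ^ 2 - 1) := by
      have : 0 ≤ D * (c ^ 2 - c - 2) := mul_nonneg hD (by
        have := mul_nonneg (sub_nonneg.2 hc2) (show 0 ≤ c + 1 by linarith)
        linarith)
      linarith
    linarith
  have hαb : |α| ≤ 2 * D := by rw [hα]; exact small p q hu1 hu2
  have hβb : |β| ≤ 2 * D := by rw [hβ]; exact small q p hu2 hu1
  -- the decomposition
  have d0 : u 0 = - m * x 1 + β * x 0 := by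
    apply mul_right_cancel₀ hq.ne'
    have : (- m * x 1 + β * x 0) * (c ^ 2 - 1) = - (m * (c ^ 2 - 1)) * x 1 + (β * (c ^ 2 - 1)) * x 0 := by ring
    rw [this, hm', hβ', hp2, hq2]
    linear_combination (-u 0) * hsq
  have d1 : u 1 = m * x 0 + β * x 1 := by
    apply mul_right_cancel₀ hq.ne'
    have : (m * x 0 + β * x 1) * (c ^ 2 - 1) = (m * (c ^ 2 - 1)) * x 0 + (β * (c ^ 2 - 1)) * x 1 := by ring
    rw [this, hm', hβ', hp2, hq2]
    linear_combination (-u 1) * hsq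
  have d2 : u 2 = α + β * c := by
    apply mul_right_cancel₀ hq.ne'
    have : (α + β * c) * (c ^ 2 - 1) = (α * (c ^ 2 - 1)) + (β * (c ^ 2 - 1)) * c := by ring
    rw [this, hα', hβ', hp2, hq2]
    ring
  -- size of κ
  have k1 : κ ^ 2 * (c ^ 2 - 1) * (c ^ 2 - 1) + (A ^ 2 + A' ^ 2 - 2 * c * A * A') = c ^ 2 - 1 := by
    have : κ ^ 2 * (c ^ 2 - 1) * (c ^ 2 - 1) = (κ * (c ^ 2 - 1)) ^ 2 := by ring
    rw [this, hκ', hA2, hA'2]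
    unfold Bform at hw
    have e : c ^ 2 = x 0 ^ 2 + x 1 ^ 2 + 1 := hsq.symm
    linear_combination (c ^ 2 - 1) * hw + (w 0 ^ 2 + w 1 ^ 2) * hsq
  have k2 : κ ^ 2 * (c ^ 2 - 1) ≥ 1 / 4 := by
    have a1 : A ^ 2 ≤ C ^ 2 := sq_le_sq' (abs_le.1 hw1).1 (abs_le.1 hw1).2
    have a2 : A' ^ 2 ≤ C ^ 2 := sq_le_sq' (abs_le.1 hw2).1 (abs_le.1 hw2).2
    have a3 : - (A * A') ≤ C ^ 2 := by
      have := sq_nonneg (A + A')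
      linarith
    have a4 : c * (-(A * A')) ≤ c * C ^ 2 := mul_le_mul_of_nonneg_left a3 (by linarith)
    have a5 : 2 * C ^ 2 * (1 + c) ≤ 3 / 4 * (c ^ 2 - 1) := by
      have b1 := mul_le_mul_of_nonneg_right hc (show 0 ≤ 1 + c by linarith)
      have b2 : 0 ≤ C ^ 2 * (1 + c) := by positivity
      linarith
    have a6 : 1 / 4 * (c ^ 2 - 1) ≤ κ ^ 2 * (c ^ 2 - 1) * (c ^ 2 - 1) := by linarith
    exact le_of_mul_le_mul_right a6 hq
  have k3 : Bform u w = m * κ * (c ^ 2 - 1) + α * A + β * A' := by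
    have e1 : Bform u w = m * (w 1 * x 0 - w 0 * x 1) + α * A + β * A' := by
      rw [hA2, hA'2]; unfold Bform; rw [d0, d1, d2]; ring
    rw [e1, ← hκ']; ring
  have k4 : |m * κ * (c ^ 2 - 1)| ≤ R + 4 * D * C := by
    have e1 : m * κ * (c ^ 2 - 1) = Bform u w - α * A - β * A' := by rw [k3]; ring
    have e2 : |α * A| ≤ 2 * D * C := by
      rw [abs_mul]; exact mul_le_mul hαb hw1 (abs_nonneg _) (by linarith)
    have e3 : |β * A'| ≤ 2 * D * C := by
      rw [abs_mul]; exact mul_le_mul hβb hw2 (abs_nonneg _) (by linarith)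
    rw [e1]
    have := abs_sub (Bform u w - α * A) (β * A')
    have := abs_sub (Bform u w) (α * A)
    linarith
  obtain ⟨R', hR'def⟩ : ∃ z, z = R + 4 * D * C := ⟨_, rfl⟩
  have hR'0 : 0 ≤ R' := by rw [hR'def]; positivity
  rw [← hR'def] at k4 ⊢
  have k5 : m ^ 2 * (c ^ 2 - 1) ≤ (2 * R') ^ 2 := by
    have e1 : (m * κ * (c ^ 2 - 1)) ^ 2 ≤ R' ^ 2 := sq_le_sq' (abs_le.1 k4).1 (abs_le.1 k4).2
    have e2 : (m * κ * (c ^ 2 - 1)) ^ 2 = (m ^ 2 * (c ^ 2 - 1)) * (κ ^ 2 * (c ^ 2 - 1)) := by ring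
    have e3 : 0 ≤ m ^ 2 * (c ^ 2 - 1) := by positivity
    have e4 := mul_le_mul_of_nonneg_left k2 e3
    rw [e2] at e1
    linarith
  have hsq' : m ^ 2 * (c ^ 2 - 1) = (m * x 0) ^ 2 + (m * x 1) ^ 2 := by rw [← hsq]; ring
  have y0 : |m * x 0| ≤ 2 * R' := abs_le_of_sq_le_sq (by have := sq_nonneg (m * x 1); linarith) (by linarith)
  have y1 : |m * x 1| ≤ 2 * R' := abs_le_of_sq_le_sq (by have := sq_nonneg (m * x 0); linarith) (by linarith)
  refine ⟨![- m * x 1, m * x 0, α], β, ?_, hβb, ?_⟩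
  · ext i; fin_cases i
    · simpa using d0
    · simpa using d1
    · simpa [← hcdef] using d2
  · intro i; fin_cases i
    · simp only [Fin.zero_eta, Matrix.cons_val_zero]; rw [neg_mul, abs_neg]; linarith
    · simp; rw [← abs_mul]; linarith
    · simp; linarith

lemma claimA (h : ∀ γ : Γ₀, SO21 (toM γ)) (hd : DiscreteTopology Γ₀)
    (hh : ∀ γ : Γ₀, γ ≠ 1 → IsHyperbolic (toM γ))
    (S : Set Γ₀) (hSfin : S.Finite) (hSgen : Subgroup.closure S = ⊤)
    {u : Γ₀ → Fin 3 → ℝ} (hu : IsCocycle Γ₀ u) (hPD : ProperlyDisc Γ₀ u) {C R : ℝ} (hC : 1 ≤ C)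
    (hR : 0 ≤ R) :
    {δ : Γ₀ | ∃ w, Bform w w = 1 ∧ |Bform w e3| ≤ C ∧ |Bform w (orb δ)| ≤ C ∧
      |Bform (u δ) w| ≤ R}.Finite := by
  obtain ⟨D, hD0, hD⟩ := growth h hd hh S hSfin hSgen hu
  set T := 2 * (R + 4 * D * C) + 2 * D with hT
  have f1 := finite_orb h hd (1 + 3 * C ^ 2)
  have f2 := hPD (Set.Icc (fun _ => -T) (fun _ => T)) isCompact_Icc
  refine (f1.union f2).subset ?_
  rintro δ ⟨w, hw, hw1, hw2, hw3⟩
  by_cases hc : orb δ 2 ≤ 1 + 3 * C ^ 2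
  · exact Or.inl hc
  · right
    obtain ⟨y, β, hy, hβ, hyb⟩ := claimA_alg (Hyp_orb h δ) hC hD0 hR (not_le.1 hc).le (hD δ).1
      (hD δ).2 hw hw1 hw2 hw3
    have h4 : 0 ≤ R + 4 * D * C := by positivity
    have hT0 : 0 ≤ T := by positivity
    have hβT : |β| ≤ T := by rw [hT]; linarith
    refine ⟨(-β) • e3, ⟨?_, ?_⟩, ?_⟩
    · intro i; fin_cases i <;> simp [e3] <;> linarith [(abs_le.1 hβT).2]
    · intro i; fin_cases i <;> simp [e3] <;> linarith [(abs_le.1 hβT).1]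
    · have : toM δ *ᵥ ((-β) • e3) + u δ = y := by
        rw [Matrix.mulVec_smul, hy, orb]; module
      rw [this]
      exact ⟨fun i => (abs_le.1 (hyb i)).1, fun i => (abs_le.1 (hyb i)).2⟩

end affsec


section finalsec
variable {Γ₀ : Subgroup (Matrix (Fin 3) (Fin 3) ℝ)ˣ}

lemma seq_pos {f : ℕ → ℝ} {C1 R : ℝ} (h0 : f 0 = 0) (h1 : ∀ i, |f (i + 1) - f i| ≤ C1)
    (hC : C1 ≤ R) (hR : 1 ≤ R) {n L : ℕ} (hL : 1 ≤ L)
    (hf : ∀ i, i + L ≤ n → R < |f (i + L) - f i|) (hs : L ≤ n → 0 ≤ f L) :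
    (n : ℝ) / L - 1 - L * C1 ≤ f n := by
  have hC0 : 0 ≤ C1 := (abs_nonneg _).trans (h1 0)
  have hpos : ∀ i, i + L ≤ n → R < f (i + L) - f i := by
    intro i
    induction i with
    | zero =>
      intro hi
      have e1 := hf 0 hi
      rw [zero_add] at hi e1 ⊢
      rw [h0, sub_zero] at e1 ⊢
      rwa [abs_of_nonneg (hs hi)] at e1
    | succ i ih =>
      intro hi
      have e1 := ih (by omega)
      have e2 := hf (i + 1) hi
      have e3 := abs_le.1 (h1 i)
      have e4 := abs_le.1 (h1 (i + L))
      rw [show i + L + 1 = i + 1 + L by omega] at e4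
      rcases lt_abs.1 e2 with h | h
      · exact h
      · linarith
  have hmul : ∀ k : ℕ, k * L ≤ n → (k : ℝ) ≤ f (k * L) := by
    intro k
    induction k with
    | zero => intro _; simp [h0]
    | succ k ih =>
      intro hk
      have e0 : (k + 1) * L = k * L + L := by ring
      have e1 := ih (by omega)
      have e2 := hpos (k * L) (by omega)
      rw [e0]; push_cast; linarith
  have hadd : ∀ i r : ℕ, f i - r * C1 ≤ f (i + r) := by
    intro i r
    induction r with
    | zero => simp
    | succ r ih =>
      have := (abs_le.1 (h1 (i + r))).1
      rw [← add_assoc]; push_cast; linarith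
  have e1 := hmul (n / L) (Nat.div_mul_le_self n L)
  have e2 := hadd (n / L * L) (n % L)
  rw [Nat.div_add_mod'] at e2
  have e3 : n % L < L := Nat.mod_lt _ hL
  have e3' : ((n % L : ℕ) : ℝ) ≤ L := by exact_mod_cast e3.le
  have e4 : (n : ℝ) / L ≤ ((n / L : ℕ) : ℝ) + 1 := by
    have hL' : (0 : ℝ) < L := by exact_mod_cast hL
    rw [div_le_iff₀ hL']
    have : n ≤ (n / L + 1) * L := by
      have := Nat.div_add_mod' n L
      rw [add_mul]; omega
    exact_mod_cast this
  have e5 := mul_le_mul_of_nonneg_right e3' hC0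
  linarith

lemma seq_abs {f : ℕ → ℝ} {C1 R : ℝ} (h0 : f 0 = 0) (h1 : ∀ i, |f (i + 1) - f i| ≤ C1)
    (hC : C1 ≤ R) (hR : 1 ≤ R) {n L : ℕ} (hL : 1 ≤ L)
    (hf : ∀ i, i + L ≤ n → R < |f (i + L) - f i|) :
    (n : ℝ) / L - 1 - L * C1 ≤ |f n| := by
  rcases le_total 0 (f L) with h | h
  · exact (seq_pos h0 h1 hC hR hL hf (fun _ => h)).trans (le_abs_self _)
  · refine (seq_pos (f := fun i => - f i) (by simp [h0]) (fun i => ?_) hC hR hL (fun i hi => ?_)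
      (fun _ => by simpa using h)).trans (neg_le_abs _)
    · rw [← abs_neg]; convert h1 i using 2; ring
    · rw [← abs_neg]; convert hf i hi using 2; ring

lemma nm_add (a b : Fin 3 → ℝ) : nm (a + b) ≤ nm a + nm b := by
  unfold nm; simp only [Pi.add_apply]
  linarith [abs_add_le (a 0) (b 0), abs_add_le (a 1) (b 1), abs_add_le (a 2) (b 2)]

lemma nm_neg (a : Fin 3 → ℝ) : nm (-a) = nm a := by
  unfold nm; simp only [Pi.neg_apply, abs_neg]

lemma nm_act (A : Matrix (Fin 3) (Fin 3) ℝ) : ∃ K : ℝ, 0 ≤ K ∧ ∀ v, nm (A *ᵥ v) ≤ K * nm v := by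
  refine ⟨∑ i, ∑ j, |A i j|, by positivity, fun v => ?_⟩
  have hv : ∀ j, |v j| ≤ nm v := by
    intro j
    unfold nm
    fin_cases j <;> simp <;> linarith [abs_nonneg (v 0), abs_nonneg (v 1), abs_nonneg (v 2)]
  have e : nm (A *ᵥ v) = ∑ i, |(A *ᵥ v) i| := by simp [nm, Fin.sum_univ_three]
  rw [e, Finset.sum_mul]
  refine Finset.sum_le_sum fun i _ => ?_
  rw [Finset.sum_mul]
  simp only [Matrix.mulVec, dotProduct]
  refine (Finset.abs_sum_le_sum_abs _ _).trans (Finset.sum_le_sum fun j _ => ?_)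
  rw [abs_mul]
  exact mul_le_mul_of_nonneg_left (hv j) (abs_nonneg _)

lemma coc_bound (S : Set Γ₀) (hSgen : Subgroup.closure S = ⊤) (γ : Γ₀) :
    ∃ K : ℝ, 0 ≤ K ∧ ∀ v : Γ₀ → Fin 3 → ℝ, IsCocycle Γ₀ v → ∀ ε : ℝ, 0 ≤ ε →
      (∀ s ∈ S, nm (v s) ≤ ε) → nm (v γ) ≤ K * ε := by
  have hγ : γ ∈ Subgroup.closure S := by rw [hSgen]; trivial
  induction hγ using Subgroup.closure_induction with
  | mem x hx => exact ⟨1, by norm_num, fun v _ ε _ hv => by rw [one_mul]; exact hv x hx⟩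
  | one =>
    refine ⟨0, le_rfl, fun v hv ε _ _ => ?_⟩
    rw [coc_one hv]; simp [nm]
  | mul a b _ _ iha ihb =>
    obtain ⟨Ka, ha0, ha⟩ := iha
    obtain ⟨Kb, hb0, hb⟩ := ihb
    obtain ⟨K, hK0, hK⟩ := nm_act (toM a)
    refine ⟨Ka + K * Kb, by positivity, fun v hv ε hε hS => ?_⟩
    rw [hv]
    have e1 := nm_add (v a) (toM a *ᵥ v b)
    have e2 := hK (v b)
    have e3 := mul_le_mul_of_nonneg_left (hb v hv ε hε hS) hK0
    have e4 := ha v hv ε hε hS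
    linarith
  | inv a _ iha =>
    obtain ⟨Ka, ha0, ha⟩ := iha
    obtain ⟨K, hK0, hK⟩ := nm_act (toM a⁻¹)
    refine ⟨K * Ka, by positivity, fun v hv ε hε hS => ?_⟩
    rw [coc_inv hv, nm_neg]
    have e2 := hK (v a)
    have e3 := mul_le_mul_of_nonneg_left (ha v hv ε hε hS) hK0
    linarith

lemma nm_le_enorm3 (v : Fin 3 → ℝ) : nm v ≤ 3 * enorm3 v := by
  have hb : ∀ t : ℝ, t ^ 2 ≤ v 0 ^ 2 + v 1 ^ 2 + v 2 ^ 2 → |t| ≤ enorm3 v := by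
    intro t ht
    rw [enorm3, ← Real.sqrt_sq_eq_abs]
    exact Real.sqrt_le_sqrt ht
  unfold nm
  linarith [hb (v 0) (by nlinarith [sq_nonneg (v 1), sq_nonneg (v 2)]),
    hb (v 1) (by nlinarith [sq_nonneg (v 0), sq_nonneg (v 2)]),
    hb (v 2) (by nlinarith [sq_nonneg (v 1), sq_nonneg (v 0)])]

/-- `|B(a,w)| ≤ nm a * (1+C)` when `w` is unit spacelike with height at most `C`. -/
lemma B_unit_le {w : Fin 3 → ℝ} {C : ℝ} (hC : 0 ≤ C) (hw : Bform w w = 1) (hw2 : |Bform w e3| ≤ C)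
    (a : Fin 3 → ℝ) : |Bform a w| ≤ nm a * (1 + C) := by
  rw [Bform_e3, abs_neg] at hw2
  have hsq : w 2 ^ 2 ≤ C ^ 2 := sq_le_sq' (abs_le.1 hw2).1 (abs_le.1 hw2).2
  unfold Bform at hw
  refine Bform_le_nm a w ?_ ?_ (by linarith)
  · exact abs_le_of_sq_le_sq (by nlinarith [sq_nonneg (w 1)]) (by linarith)
  · exact abs_le_of_sq_le_sq (by nlinarith [sq_nonneg (w 0)]) (by linarith)

lemma coc_diff (h : ∀ γ : Γ₀, SO21 (toM γ)) {v : Γ₀ → Fin 3 → ℝ} (hv : IsCocycle Γ₀ v)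
    (a b : Γ₀) (N : Fin 3 → ℝ) :
    Bform (v b) N - Bform (v a) N = Bform (v (a⁻¹ * b)) (toM a⁻¹ *ᵥ N) := by
  have e1 : v b = v a + toM a *ᵥ v (a⁻¹ * b) := by
    rw [← hv, mul_inv_cancel_left]
  rw [e1, Bform_add_left, B_act_left h]
  ring

end finalsec

/-- properly discontinuous affine deformations of a Schottky group generated
by a finite set `S` form an open set: any cocycle sufficiently close to a proper one on
the generators `S` is again proper. -/
theorem stmt_15 (Γ₀ : Subgroup (Matrix (Fin 3) (Fin 3) ℝ)ˣ) (hS : IsSchottky Γ₀)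
    (S : Set Γ₀) (hSfin : S.Finite) (hSgen : Subgroup.closure S = ⊤)
    (u : Γ₀ → Fin 3 → ℝ) (hu : IsCocycle Γ₀ u) (hPD : ProperlyDisc Γ₀ u) :
    ∃ ε : ℝ, 0 < ε ∧ ∀ u' : Γ₀ → Fin 3 → ℝ, IsCocycle Γ₀ u' →
      (∀ γ ∈ S, enorm3 (u' γ - u γ) < ε) → ProperlyDisc Γ₀ u' := by
  obtain ⟨h, hd, -, hh⟩ := hS
  obtain ⟨C, hC1, hC⟩ := chain h hd hh S hSfin hSgen
  have hF := finite_orb h hd C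
  obtain ⟨M, hM0, hM⟩ := fin_bound hF (fun s => nm (u s))
  set C1 := M * (1 + C) with hC1def
  have hC10 : 0 ≤ C1 := by positivity
  set R := max C1 1 with hRdef
  have hfin := claimA h hd hh S hSfin hSgen hu hPD hC1 (show 0 ≤ R from hC10.trans (le_max_left _ _))
  obtain ⟨Q, hQ0, hQ⟩ := fin_bound hfin (fun δ => orb δ 2)
  obtain ⟨L, hL⟩ : ∃ L : ℕ, C * Q < L := exists_nat_gt _
  have hL1 : 1 ≤ L := by
    rcases Nat.eq_zero_or_pos L with h0 | h0
    · rw [h0, Nat.cast_zero] at hL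
      have : 0 ≤ C * Q := by positivity
      linarith
    · exact h0
  have hLpos : (0 : ℝ) < L := by exact_mod_cast hL1
  choose K hK0 hK using coc_bound S hSgen
  obtain ⟨K6, hK60, hK6⟩ := fin_bound hF K
  -- common facts on the chain
  have hw : ∀ (N : Fin 3 → ℝ) (g : Γ₀), Bform N N = 1 → |Bform N (orb g)| ≤ C →
      Bform (toM g⁻¹ *ᵥ N) (toM g⁻¹ *ᵥ N) = 1 ∧ |Bform (toM g⁻¹ *ᵥ N) e3| ≤ C := by
    intro N g h1 h2
    refine ⟨by rw [B_act h]; exact h1, ?_⟩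
    rw [B_act_left h, inv_inv]; exact h2
  set ε := 1 / (2 * L * (1 + C) * (K6 + 1) * 3) with hε
  have hεpos : 0 < ε := by positivity
  refine ⟨ε, hεpos, fun u' hu' hclose => ?_⟩
  set v : Γ₀ → Fin 3 → ℝ := fun γ => u' γ - u γ with hv
  have hvc : IsCocycle Γ₀ v := by
    intro a b
    simp only [hv]
    rw [hu', hu, Matrix.mulVec_sub]; abel
  have hvF : ∀ s : Γ₀, orb s 2 ≤ C → nm (v s) ≤ K6 * (3 * ε) := by
    intro s hs
    have e1 := hK s v hvc (3 * ε) (by positivity) (fun t ht => by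
      have := nm_le_enorm3 (v t)
      have := hclose t ht
      linarith)
    exact e1.trans (mul_le_mul_of_nonneg_right (hK6 s hs) (by positivity))
  have hη : K6 * (3 * ε) * (1 + C) ≤ 1 / (2 * L) := by
    rw [hε, le_div_iff₀ (by positivity)]
    have : K6 * (3 * (1 / (2 * L * (1 + C) * (K6 + 1) * 3))) * (1 + C) * (2 * L) = K6 / (K6 + 1) := by
      field_simp
    rw [this, div_le_one (by positivity)]; linarith
  intro T hT
  obtain ⟨T0, hT0⟩ := hT.isBounded.exists_norm_le
  have hTn : ∀ x ∈ T, nm x ≤ 3 * T0 := by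
    intro x hx
    have e := hT0 x hx
    have e' := fun i => (norm_le_pi_norm x i).trans e
    simp only [Real.norm_eq_abs] at e'
    unfold nm; linarith [e' 0, e' 1, e' 2]
  set n0 := (6 * T0 + 1 + L * C1) * (2 * L) with hn0
  refine (finite_orb h hd (C * Real.exp n0)).subset ?_
  rintro γ ⟨x, hx, hy⟩
  obtain ⟨N, n, g, hg0, hgn, hNN, hNe, hNg, hNi, hs, hup, hlow⟩ := hC γ
  have h1 := seq_abs (f := fun i => Bform (u (g i)) N) (C1 := C1) (R := R) (n := n) (L := L)
    (by rw [hg0, coc_one hu]; simp [Bform])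
    (fun i => by
      rw [coc_diff h hu]
      obtain ⟨w1, w2⟩ := hw N (g i) hNN (hNi i)
      exact (B_unit_le (by linarith) w1 w2 _).trans
        (mul_le_mul_of_nonneg_right (hM _ (hs i)) (by linarith)))
    (le_max_left _ _) (le_max_right _ _) hL1
    (fun i hi => by
      rw [coc_diff h hu]
      by_contra hcon
      obtain ⟨w1, w2⟩ := hw N (g i) hNN (hNi i)
      have hmem := hQ ((g i)⁻¹ * g (i + L)) ⟨toM (g i)⁻¹ *ᵥ N, w1, w2, by
        rw [orb_mul, B_act h]; exact hNi _, not_lt.1 hcon⟩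
      have e1 := hlow i L hi
      have e2 := Real.add_one_le_exp (L : ℝ)
      have e3 := mul_le_mul_of_nonneg_left hmem (show 0 ≤ C by linarith)
      linarith)
  simp only [hgn] at h1
  -- the perturbation
  have h2 : ∀ k : ℕ, |Bform (v (g k)) N| ≤ k * (1 / (2 * L)) := by
    intro k
    induction k with
    | zero => rw [hg0, coc_one hvc]; simp [Bform]
    | succ k ih =>
      obtain ⟨w1, w2⟩ := hw N (g k) hNN (hNi k)
      have e1 := coc_diff h hvc (g k) (g (k + 1)) N
      have e2 := (B_unit_le (by linarith) w1 w2 (v ((g k)⁻¹ * g (k + 1)))).trans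
        (mul_le_mul_of_nonneg_right (hvF _ (hs k)) (by linarith))
      rw [← e1] at e2
      have e3 := abs_add_le (Bform (v (g k)) N) (Bform (v (g (k + 1))) N - Bform (v (g k)) N)
      rw [add_sub_cancel] at e3
      push_cast
      linarith
  have h3 := h2 n
  rw [hgn] at h3
  -- the upper bound
  have hNe' : |Bform N e3| ≤ 0 := by rw [hNe, abs_zero]
  have hwe : Bform (toM γ⁻¹ *ᵥ N) e3 = 0 := by rw [B_act_left h, inv_inv]; exact hNg
  have hwN : Bform (toM γ⁻¹ *ᵥ N) (toM γ⁻¹ *ᵥ N) = 1 := by rw [B_act h]; exact hNN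
  have b1 := B_unit_le le_rfl hNN hNe' (toM γ *ᵥ x + u' γ)
  have b2 := B_unit_le le_rfl hwN (by rw [hwe, abs_zero]) x
  rw [← B_act_left h] at b2
  have b3 := hTn _ hx
  have b4 := hTn _ hy
  have b5 : Bform (u γ) N = Bform (toM γ *ᵥ x + u' γ) N - Bform (toM γ *ᵥ x) N - Bform (v γ) N := by
    simp only [hv]; rw [Bform_add_left, Bform_sub_left]; ring
  have b6 := abs_sub (Bform (toM γ *ᵥ x + u' γ) N - Bform (toM γ *ᵥ x) N) (Bform (v γ) N)
  have b7 := abs_sub (Bform (toM γ *ᵥ x + u' γ) N) (Bform (toM γ *ᵥ x) N)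
  rw [← b5] at b6
  have b8 : (n : ℝ) / L - n * (1 / (2 * L)) ≤ 6 * T0 + 1 + L * C1 := by linarith
  have b9 : (n : ℝ) / L - n * (1 / (2 * L)) = n / (2 * L) := by field_simp; ring
  rw [b9, div_le_iff₀ (by positivity)] at b8
  have b10 := hup n
  rw [hgn] at b10
  exact b10.trans (mul_le_mul_of_nonneg_left (Real.exp_le_exp.2 b8) (by linarith))

end
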